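/- arXiv:2503.01575 — 4 statements merged into one kernel-verified Lean document; each statement's English description precedes it below -/
import Mathlib

section
/- Let ε>0, 0<α<1≤M, and β∈[0, ε/(1+ε)). Let {a_n}_{n≥1} and {b_n}_{n≥1} be sequences of complex numbers such that for all n: n^{1+ε} ≤ |a_n| ≤ |a_{n+1}| and |b_n| < |a_n|^β · 2^{(log₂|a_n|)^α}. If limsup_{n→∞} |a_n|^{(M/(1−β)+1)^{−n}} = ∞, then for every fixed c with 0<c<1, liminf_{N→∞} ( Σ_{n=N+1}^∞ |b_n/a_n| ) · ( ∏_{n=1}^N |a_n|^M ) · 2^{N²(log₂|a_{N−1}|)^c} = 0. -/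
open Filter

/-- A damped geometric sequence whose partial sums beat the geometric ratio by `1 - 1 / t ^ 2`. -/
noncomputable def dampedGeom (K : ℝ) (n : ℕ) : ℝ := K ^ n * ((n : ℝ) / (n + 1))

lemma dampedGeom_pos {K : ℝ} (hK : 2 ≤ K) {n : ℕ} (hn : 1 ≤ n) : 0 < dampedGeom K n := by
  have : (0 : ℝ) < n := by exact_mod_cast hn
  unfold dampedGeom
  positivity

lemma dampedGeom_le_pow {K : ℝ} (hK : 2 ≤ K) (n : ℕ) : dampedGeom K n ≤ K ^ n := by
  unfold dampedGeom
  refine mul_le_of_le_one_right (by positivity) ?_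
  rw [div_le_one (by positivity)]
  linarith

lemma div_succ_mono {s t : ℕ} (h : s ≤ t) :
    (s : ℝ) / (s + 1) ≤ (t : ℝ) / (t + 1) := by
  have : (s : ℝ) ≤ t := by exact_mod_cast h
  rw [div_le_div_iff₀ (by positivity) (by positivity)]
  linarith

lemma dampedGeom_mul_pow_le {K : ℝ} (hK : 2 ≤ K) (s k : ℕ) :
    dampedGeom K s * K ^ k ≤ dampedGeom K (s + k) := by
  unfold dampedGeom
  calc K ^ s * ((s : ℝ) / (s + 1)) * K ^ k = K ^ (s + k) * ((s : ℝ) / (s + 1)) := by ring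
    _ ≤ _ := by
      exact mul_le_mul_of_nonneg_left (div_succ_mono (Nat.le_add_right s k)) (by positivity)

lemma dampedGeom_mono {K : ℝ} (hK : 2 ≤ K) {s t : ℕ} (h : s ≤ t) :
    dampedGeom K s ≤ dampedGeom K t := by
  unfold dampedGeom
  have := div_succ_mono h
  gcongr
  linarith

lemma sum_dampedGeom_le {K : ℝ} (hK : 2 ≤ K) {t : ℕ} (ht : 1 ≤ t) :
    ∑ n ∈ Finset.range t, dampedGeom K n ≤
      dampedGeom K t * ((1 - 1 / (t : ℝ) ^ 2) / (K - 1)) := by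
  have ht' : (0 : ℝ) < t := by exact_mod_cast ht
  have hK1 : 0 < K - 1 := by linarith
  have h1 : ∑ n ∈ Finset.range t, dampedGeom K n ≤
      ∑ n ∈ Finset.range t, K ^ n * (((t : ℝ) - 1) / t) := by
    refine Finset.sum_le_sum fun n hn => ?_
    have h := div_succ_mono (Nat.le_sub_one_of_lt (Finset.mem_range.1 hn))
    rw [Nat.cast_sub ht] at h
    exact mul_le_mul_of_nonneg_left (by simpa using h) (by positivity)
  refine h1.trans ?_
  rw [← Finset.sum_mul, geom_sum_eq (by linarith)]
  have h2 : (K ^ t - 1) / (K - 1) ≤ K ^ t / (K - 1) := by gcongr; linarith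
  have h3 : (0 : ℝ) ≤ ((t : ℝ) - 1) / t := by
    have : (1 : ℝ) ≤ t := by exact_mod_cast ht
    exact div_nonneg (by linarith) ht'.le
  refine (mul_le_mul_of_nonneg_right h2 h3).trans (le_of_eq ?_)
  unfold dampedGeom
  field_simp
  ring

/-- If a nonnegative monotone sequence satisfies `L (2 * t) ≤ D * Y` whenever `Y ≤ L t` is an
exponentially large bound dominating the earlier terms, with their sum slightly below
`Y / (K - 1)`, then it grows at most like `K ^ n`. -/
lemma exists_le_mul_pow_of_forall_record {K D : ℝ} (hK : 2 ≤ K) (hD : 1 ≤ D) {L : ℕ → ℝ}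
    (hL0 : ∀ n, 1 ≤ n → 0 ≤ L n) (hLm : ∀ m n, 1 ≤ m → m ≤ n → L m ≤ L n)
    (hrec : ∀ᶠ t : ℕ in atTop, ∀ Y : ℝ, (5 / 4 : ℝ) ^ t ≤ Y → Y ≤ L t →
      (∀ n, 1 ≤ n → n < t → L n ≤ Y) →
      ∑ n ∈ Finset.Ico 1 t, L n ≤
        Y * ((4 / 5 : ℝ) ^ t + (1 - 1 / (t : ℝ) ^ 2) / (K - 1)) →
      L (2 * t) ≤ D * Y) :
    ∃ S : ℝ, ∀ᶠ n in atTop, L n ≤ S * K ^ n := by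
  have hgrow : ∀ᶠ t : ℕ in atTop, 1 + 2 * t * D ≤ (5 / 4 : ℝ) ^ t := by
    have h1 : Tendsto (fun t : ℕ => (1 + 2 * t * D) / (5 / 4 : ℝ) ^ t) atTop (nhds 0) := by
      have ha := tendsto_pow_const_div_const_pow_of_one_lt 0 (r := (5 / 4 : ℝ)) (by norm_num)
      have hb := tendsto_pow_const_div_const_pow_of_one_lt 1 (r := (5 / 4 : ℝ)) (by norm_num)
      have := ha.add (hb.const_mul (2 * D))
      simp only [mul_zero, add_zero] at this
      refine this.congr fun t => ?_
      ring
    filter_upwards [h1.eventually (gt_mem_nhds one_pos)] with t ht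
    rw [div_lt_one (by positivity)] at ht
    exact ht.le
  obtain ⟨s₀, hs₀⟩ := eventually_atTop.1 ((hrec.and hgrow).and (eventually_ge_atTop 1))
  have key : ∀ d : ℕ, ∀ s n : ℕ, ∀ l : ℝ, n - s ≤ d → s₀ ≤ s → s < n →
      (1 + ∑ i ∈ Finset.Ico 1 (s + 1), L i) * (5 / 4 : ℝ) ^ s ≤ l * dampedGeom K s →
      L n ≤ D * (l * dampedGeom K n) := by
    intro d
    induction d with
    | zero => intro s n l h1 h2 h3; omega
    | succ d ih =>
      intro s n l hd hs hsn hinv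
      by_contra! hlt
      have hs1 : 1 ≤ s := (hs₀ s hs).2
      have hsum0 : 0 ≤ ∑ i ∈ Finset.Ico 1 (s + 1), L i :=
        Finset.sum_nonneg fun i hi => hL0 i (Finset.mem_Ico.1 hi).1
      have hgs := dampedGeom_pos hK hs1
      have hl : 0 < l := by
        have : 0 < l * dampedGeom K s := lt_of_lt_of_le (by positivity) hinv
        exact pos_of_mul_pos_left this hgs.le
      have hex : ∃ t, s < t ∧ l * dampedGeom K t ≤ L t := by
        refine ⟨n, hsn, le_trans ?_ hlt.le⟩
        have := dampedGeom_pos hK (hs1.trans hsn.le)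
        exact le_mul_of_one_le_left (by positivity) hD
      classical
      let t := Nat.find hex
      obtain ⟨hst, hLt⟩ : s < t ∧ l * dampedGeom K t ≤ L t := Nat.find_spec hex
      have hmin : ∀ m, s < m → m < t → L m < l * dampedGeom K m := by
        intro m h1 h2
        have := Nat.find_min hex h2
        push Not at this
        exact this h1
      have htn : t ≤ n := Nat.find_min' hex ⟨hsn, by
        have := dampedGeom_pos hK (hs1.trans hsn.le)
        exact (le_mul_of_one_le_left (by positivity) hD).trans hlt.le⟩
      clear_value t
      have ht1 : 1 ≤ t := by omega
      obtain ⟨⟨hrt, hgt⟩, -⟩ := hs₀ t (by omega)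
      set Y := l * dampedGeom K t with hY
      have hinvt : (1 + ∑ i ∈ Finset.Ico 1 (s + 1), L i) * (5 / 4 : ℝ) ^ t ≤ Y := by
        obtain ⟨k, rfl⟩ := Nat.exists_eq_add_of_le hst.le
        calc (1 + ∑ i ∈ Finset.Ico 1 (s + 1), L i) * (5 / 4 : ℝ) ^ (s + k)
            = (1 + ∑ i ∈ Finset.Ico 1 (s + 1), L i) * (5 / 4 : ℝ) ^ s * (5 / 4 : ℝ) ^ k := by
              ring
          _ ≤ (l * dampedGeom K s) * K ^ k := by
              gcongr
              linarith
          _ = l * (dampedGeom K s * K ^ k) := by ring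
          _ ≤ _ := by
              rw [hY]
              gcongr
              exact dampedGeom_mul_pow_le hK s k
      have hqt : (1 : ℝ) ≤ (5 / 4 : ℝ) ^ t := one_le_pow₀ (by norm_num)
      have hqY : (5 / 4 : ℝ) ^ t ≤ Y := by nlinarith
      have hsumY : ∑ i ∈ Finset.Ico 1 (s + 1), L i ≤ Y * (4 / 5 : ℝ) ^ t := by
        have h54 : (5 / 4 : ℝ) ^ t * (4 / 5 : ℝ) ^ t = 1 := by
          rw [← mul_pow]; norm_num
        calc ∑ i ∈ Finset.Ico 1 (s + 1), L i
            ≤ (1 + ∑ i ∈ Finset.Ico 1 (s + 1), L i) * ((5 / 4 : ℝ) ^ t * (4 / 5 : ℝ) ^ t) := by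
              rw [h54]; linarith
          _ = (1 + ∑ i ∈ Finset.Ico 1 (s + 1), L i) * (5 / 4 : ℝ) ^ t * (4 / 5 : ℝ) ^ t := by
              ring
          _ ≤ _ := by gcongr
      have hle : ∀ i, 1 ≤ i → i < t → L i ≤ Y := by
        intro i hi hit
        by_cases his : i ≤ s
        · have h1 : L i ≤ ∑ i ∈ Finset.Ico 1 (s + 1), L i :=
            Finset.single_le_sum (f := L) (fun j hj => hL0 j (Finset.mem_Ico.1 hj).1)
              (Finset.mem_Ico.2 ⟨hi, by omega⟩)
          nlinarith
        · refine (hmin i (by omega) hit).le.trans ?_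
          rw [hY]
          gcongr
          exact dampedGeom_mono hK hit.le
      have hsumt : ∑ i ∈ Finset.Ico 1 t, L i ≤
          Y * ((4 / 5 : ℝ) ^ t + (1 - 1 / (t : ℝ) ^ 2) / (K - 1)) := by
        rw [← Finset.sum_Ico_consecutive L (by omega : 1 ≤ s + 1) (by omega : s + 1 ≤ t), mul_add]
        refine add_le_add hsumY ?_
        calc ∑ i ∈ Finset.Ico (s + 1) t, L i ≤ ∑ i ∈ Finset.Ico (s + 1) t, l * dampedGeom K i := by
              refine Finset.sum_le_sum fun i hi => ?_
              obtain ⟨h1, h2⟩ := Finset.mem_Ico.1 hi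
              exact (hmin i h1 h2).le
          _ ≤ ∑ i ∈ Finset.range t, l * dampedGeom K i := by
              refine Finset.sum_le_sum_of_subset_of_nonneg ?_ fun i _ _ => ?_
              · intro i hi
                exact Finset.mem_range.2 (Finset.mem_Ico.1 hi).2
              · have : 0 ≤ dampedGeom K i := by unfold dampedGeom; positivity
                positivity
          _ ≤ _ := by
              rw [← Finset.mul_sum, hY, mul_assoc]
              gcongr
              exact sum_dampedGeom_le hK ht1
      have h2t := hrt Y hqY hLt hle hsumt
      have hgt0 := dampedGeom_pos hK ht1
      have hg2t := dampedGeom_pos hK (by omega : 1 ≤ 2 * t)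
      have h2tn : 2 * t < n := by
        by_contra! hcon
        have h1 := hLm n (2 * t) (by omega) hcon
        have h3 : D * (l * dampedGeom K t) ≤ D * (l * dampedGeom K n) := by
          gcongr
          exact dampedGeom_mono hK htn
        linarith
      have hY1 : 1 ≤ Y := hqt.trans hqY
      have hnew := ih (2 * t) n ((5 / 4 : ℝ) ^ (3 * t) * Y / dampedGeom K (2 * t))
        (by omega) (by omega) h2tn (by
          rw [div_mul_cancel₀ _ hg2t.ne']
          have h1 : ∑ i ∈ Finset.Ico 1 (2 * t + 1), L i ≤ 2 * t * (D * Y) := by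
            calc ∑ i ∈ Finset.Ico 1 (2 * t + 1), L i
                ≤ ∑ i ∈ Finset.Ico 1 (2 * t + 1), D * Y := by
                  refine Finset.sum_le_sum fun i hi => ?_
                  obtain ⟨h1, h2⟩ := Finset.mem_Ico.1 hi
                  exact (hLm i (2 * t) h1 (by omega)).trans h2t
              _ = _ := by simp
          calc (1 + ∑ i ∈ Finset.Ico 1 (2 * t + 1), L i) * (5 / 4 : ℝ) ^ (2 * t)
              ≤ ((1 + 2 * t * D) * Y) * (5 / 4 : ℝ) ^ (2 * t) := by
                gcongr
                nlinarith
            _ ≤ ((5 / 4 : ℝ) ^ t * Y) * (5 / 4 : ℝ) ^ (2 * t) := by gcongr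
            _ = _ := by ring)
      refine absurd hnew (not_le.2 (lt_of_le_of_lt ?_ hlt))
      have hgn := dampedGeom_pos hK (hs1.trans hsn.le)
      have : (5 / 4 : ℝ) ^ (3 * t) * Y / dampedGeom K (2 * t) ≤ l := by
        rw [div_le_iff₀ hg2t, hY]
        have h1 : (5 / 4 : ℝ) ^ (3 * t) ≤ K ^ t := by
          rw [pow_mul]
          gcongr
          linarith
        have h2 := dampedGeom_mul_pow_le hK t t
        rw [← two_mul] at h2
        calc (5 / 4 : ℝ) ^ (3 * t) * (l * dampedGeom K t) ≤ K ^ t * (l * dampedGeom K t) := by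
              gcongr
          _ = l * (dampedGeom K t * K ^ t) := by ring
          _ ≤ _ := by gcongr
      gcongr
  have hg0 := dampedGeom_pos hK (hs₀ s₀ le_rfl).2
  set l := (1 + ∑ i ∈ Finset.Ico 1 (s₀ + 1), L i) * (5 / 4 : ℝ) ^ s₀ / dampedGeom K s₀ with hl
  refine ⟨D * l, ?_⟩
  filter_upwards [eventually_gt_atTop s₀] with n hn
  refine (key _ s₀ n l le_rfl le_rfl hn (by rw [hl, div_mul_cancel₀ _ hg0.ne'])).trans ?_
  have hl0 : 0 ≤ l := by
    have : 0 ≤ ∑ i ∈ Finset.Ico 1 (s₀ + 1), L i :=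
      Finset.sum_nonneg fun i hi => hL0 i (Finset.mem_Ico.1 hi).1
    positivity
  rw [mul_assoc]
  gcongr
  exact dampedGeom_le_pow hK n

/-- A power with exponent below one is dominated by any line of positive slope. -/
lemma exists_rpow_le_mul_add {α η : ℝ} (hα : 0 < α) (hα1 : α < 1) (hη : 0 < η) :
    ∃ C : ℝ, ∀ x : ℝ, 0 ≤ x → x ^ α ≤ η * x + C := by
  have h := (tendsto_rpow_neg_atTop (by linarith : 0 < 1 - α)).eventually (gt_mem_nhds hη)
  obtain ⟨x₀, hx₀⟩ := eventually_atTop.1 (h.and (eventually_gt_atTop 0))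
  have hx₀0 : 0 < x₀ := (hx₀ x₀ le_rfl).2
  refine ⟨x₀ ^ α, fun x hx => ?_⟩
  rcases le_total x x₀ with hle | hle
  · have := Real.rpow_le_rpow hx hle hα.le
    nlinarith
  · obtain ⟨h1, h2⟩ := hx₀ x hle
    have h3 : x ^ α = x ^ (-(1 - α)) * x := by
      rw [← Real.rpow_add_one h2.ne']
      congr 1
      ring
    have h4 : 0 ≤ x₀ ^ α := by positivity
    rw [h3]
    nlinarith

lemma tsum_ofReal_tail_le {ε α θ : ℝ} (hε : 0 < ε) (hα : 0 < α) (hα1 : α < 1)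
    (hθ : 1 / (1 + ε) < θ) {L x : ℕ → ℝ}
    (hL0 : ∀ n, 1 ≤ n → 0 ≤ L n) (hLm : ∀ m n, 1 ≤ m → m ≤ n → L m ≤ L n)
    (hLlog : ∀ n : ℕ, 1 ≤ n → (1 + ε) * Real.logb 2 n ≤ L n)
    (hx : ∀ n, 1 ≤ n → x n ≤ 2 ^ (L n ^ α - θ * L n)) :
    ∃ η C : ℝ, 0 < η ∧ 0 < C ∧ ∀ m, 1 ≤ m →
      ∑' j : ℕ, ENNReal.ofReal (x (m + j)) ≤ ENNReal.ofReal (C * 2 ^ (-(η * L m))) := by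
  obtain ⟨η, hη, hθη⟩ : ∃ η : ℝ, 0 < η ∧ θ = 1 / (1 + ε) + 3 * η :=
    ⟨(θ - 1 / (1 + ε)) / 3, by linarith, by ring⟩
  obtain ⟨C, hC⟩ := exists_rpow_le_mul_add hα hα1 hη
  set p : ℝ := 1 + (1 + ε) * η with hp
  have hp1 : 1 < p := by rw [hp]; nlinarith
  have hsum : Summable fun n : ℕ => ((n : ℝ) ^ p)⁻¹ := Real.summable_nat_rpow_inv.2 hp1
  have hterm : ∀ m n : ℕ, 1 ≤ m → m ≤ n →
      x n ≤ (2 ^ C * 2 ^ (-(η * L m))) * ((n : ℝ) ^ p)⁻¹ := by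
    intro m n hm hmn
    have hn : 1 ≤ n := hm.trans hmn
    have hn0 : (0 : ℝ) < n := by exact_mod_cast hn
    have hpow : ((n : ℝ) ^ p)⁻¹ = 2 ^ (-(p * Real.logb 2 n)) := by
      rw [← Real.rpow_neg hn0.le]
      nth_rewrite 1 [← Real.rpow_logb (b := 2) (by norm_num) (by norm_num) hn0]
      rw [← Real.rpow_mul (by norm_num)]
      congr 1
      ring
    rw [hpow, ← Real.rpow_add (by norm_num), ← Real.rpow_add (by norm_num)]
    refine (hx n hn).trans (Real.rpow_le_rpow_of_exponent_le (by norm_num) ?_)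
    have h1 := hC (L n) (hL0 n hn)
    have h2 := hLm m n hm hmn
    have h3 : p * Real.logb 2 n ≤ (1 / (1 + ε) + η) * L n := by
      have : p = (1 / (1 + ε) + η) * (1 + ε) := by rw [hp]; field_simp
      rw [this, mul_assoc]
      exact mul_le_mul_of_nonneg_left (hLlog n hn) (by positivity)
    have h4 : η * L m ≤ η * L n := by gcongr
    rw [hθη]
    linarith
  have hsum0 : 0 ≤ ∑' n : ℕ, ((n : ℝ) ^ p)⁻¹ := tsum_nonneg fun n => by positivity
  refine ⟨η, 2 ^ C * (1 + ∑' n : ℕ, ((n : ℝ) ^ p)⁻¹), hη, by positivity, fun m hm => ?_⟩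
  calc ∑' j : ℕ, ENNReal.ofReal (x (m + j))
      ≤ ∑' j : ℕ, ENNReal.ofReal (2 ^ C * 2 ^ (-(η * L m))) *
          ENNReal.ofReal ((((m + j : ℕ) : ℝ) ^ p)⁻¹) := by
        refine ENNReal.tsum_le_tsum fun j => ?_
        rw [← ENNReal.ofReal_mul (by positivity)]
        exact ENNReal.ofReal_le_ofReal (hterm m (m + j) hm (by omega))
    _ = ENNReal.ofReal (2 ^ C * 2 ^ (-(η * L m))) *
          ∑' j : ℕ, ENNReal.ofReal ((((m + j : ℕ) : ℝ) ^ p)⁻¹) := ENNReal.tsum_mul_left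
    _ ≤ ENNReal.ofReal (2 ^ C * 2 ^ (-(η * L m))) *
          ∑' n : ℕ, ENNReal.ofReal (((n : ℝ) ^ p)⁻¹) := by
        refine mul_le_mul_right ?_ _
        exact ENNReal.tsum_comp_le_tsum_of_injective (add_right_injective m)
          (fun n : ℕ => ENNReal.ofReal (((n : ℝ) ^ p)⁻¹))
    _ = ENNReal.ofReal (2 ^ C * 2 ^ (-(η * L m))) *
          ENNReal.ofReal (∑' n : ℕ, ((n : ℝ) ^ p)⁻¹) := by
        rw [ENNReal.ofReal_tsum_of_nonneg (fun n => by positivity) hsum]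
    _ ≤ _ := by
        rw [← ENNReal.ofReal_mul (by positivity)]
        refine ENNReal.ofReal_le_ofReal ?_
        have : (0 : ℝ) < 2 ^ C * 2 ^ (-(η * L m)) := by positivity
        nlinarith

/-- The exponent `θ * y - y ^ α` is increasing past any point where it is nonnegative. -/
lemma mul_sub_rpow_le {α θ Y y : ℝ} (hα1 : α < 1) (hY : 0 < Y) (hYy : Y ≤ y)
    (hθ : Y ^ (α - 1) ≤ θ) : θ * Y - Y ^ α ≤ θ * y - y ^ α := by
  have hy : 0 < y := hY.trans_le hYy
  have h1 : Y ^ α = Y ^ (α - 1) * Y := by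
    rw [← Real.rpow_add_one hY.ne']; congr 1; ring
  have h2 : y ^ α = y ^ (α - 1) * y := by
    rw [← Real.rpow_add_one hy.ne']; congr 1; ring
  have h3 : y ^ (α - 1) ≤ Y ^ (α - 1) :=
    Real.rpow_le_rpow_of_nonpos hY hYy (by linarith)
  rw [h1, h2]
  nlinarith [mul_le_mul_of_nonneg_right h3 hy.le, mul_nonneg (sub_nonneg.2 hθ) (sub_nonneg.2 hYy)]

lemma tsum_ofReal_le_of_tail {α θ η C Y : ℝ} (hα1 : α < 1) {L x : ℕ → ℝ}
    (hLm : ∀ m n, 1 ≤ m → m ≤ n → L m ≤ L n)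
    (hx : ∀ n, 1 ≤ n → x n ≤ 2 ^ (L n ^ α - θ * L n)) (hC : 0 < C) {t : ℕ} (ht : 1 ≤ t)
    (htail : ∑' j : ℕ, ENNReal.ofReal (x (2 * t + j)) ≤
      ENNReal.ofReal (C * 2 ^ (-(η * L (2 * t)))))
    (hY : 0 < Y) (hYL : Y ≤ L t) (hYθ : Y ^ (α - 1) ≤ θ) :
    ∑' j : ℕ, ENNReal.ofReal (x (t + j)) ≤
      ENNReal.ofReal (t * 2 ^ (Y ^ α - θ * Y) + C * 2 ^ (-(η * L (2 * t)))) := by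
  have hshift : ∀ j, t + (j + t) = 2 * t + j := fun j => by ring
  rw [← (ENNReal.summable (f := fun j : ℕ => ENNReal.ofReal (x (t + (j + t))))).sum_add_tsum_nat_add'
    (f := fun j : ℕ => ENNReal.ofReal (x (t + j))),
    ENNReal.ofReal_add (by positivity) (by positivity)]
  simp only [hshift]
  refine add_le_add ?_ htail
  calc ∑ j ∈ Finset.range t, ENNReal.ofReal (x (t + j))
      ≤ ∑ j ∈ Finset.range t, ENNReal.ofReal (2 ^ (Y ^ α - θ * Y)) := by
        refine Finset.sum_le_sum fun j _ => ENNReal.ofReal_le_ofReal ?_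
        refine (hx (t + j) (by omega)).trans
          (Real.rpow_le_rpow_of_exponent_le (by norm_num) ?_)
        have := mul_sub_rpow_le hα1 hY (hYL.trans (hLm t (t + j) ht (by omega))) hYθ
        linarith
    _ = _ := by
        rw [Finset.sum_const, Finset.card_range, nsmul_eq_mul, ENNReal.ofReal_mul (by positivity),
          ENNReal.ofReal_natCast]

lemma eventually_slack_lt {α c M θ : ℝ} (hα1 : α < 1) (hc1 : c < 1) (hθ : 0 < θ) :
    ∀ᶠ t : ℕ in atTop, (t : ℝ) ^ 2 * (((5 / 4 : ℝ) ^ t) ^ (α - 1) +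
      t ^ 2 * ((5 / 4 : ℝ) ^ t) ^ (c - 1) + (M + t) * (4 / 5 : ℝ) ^ t) < θ := by
  have hlim : ∀ (k : ℕ) (e : ℝ), e < 1 →
      Tendsto (fun t : ℕ => (t : ℝ) ^ k * ((5 / 4 : ℝ) ^ t) ^ (e - 1)) atTop (nhds 0) := by
    intro k e he
    have h1 : |(5 / 4 : ℝ) ^ (e - 1)| < 1 := by
      rw [abs_of_pos (by positivity)]
      exact Real.rpow_lt_one_of_one_lt_of_neg (by norm_num) (by linarith)
    refine (tendsto_pow_const_mul_const_pow_of_abs_lt_one k h1).congr fun t => ?_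
    rw [← Real.rpow_natCast, ← Real.rpow_natCast, ← Real.rpow_natCast,
      ← Real.rpow_mul (by norm_num), ← Real.rpow_mul (by norm_num), mul_comm (e - 1)]
  have hlim2 : ∀ k : ℕ, Tendsto (fun t : ℕ => (t : ℝ) ^ k * (4 / 5 : ℝ) ^ t) atTop (nhds 0) :=
    fun k => tendsto_pow_const_mul_const_pow_of_abs_lt_one k (by norm_num [abs_lt])
  have h := (((hlim 2 α hα1).add (hlim 4 c hc1)).add ((hlim2 2).const_mul M)).add (hlim2 3)
  simp only [mul_zero, add_zero] at h
  filter_upwards [h.eventually (gt_mem_nhds hθ)] with t ht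
  refine lt_of_eq_of_lt ?_ ht
  ring

/-- If the weighted tails of a series with terms `2 ^ (L n ^ α - θ * L n)` do not become small,
the exponents `L n` grow at most geometrically with ratio `M / θ + 1`. -/
lemma exists_le_mul_pow_of_tail_ge {ε α θ M c δ : ℝ} (hε : 0 < ε) (hα : 0 < α) (hα1 : α < 1)
    (hM : 1 ≤ M) (hθ : 1 / (1 + ε) < θ) (hθ1 : θ ≤ 1) (hc : 0 < c) (hc1 : c < 1) (hδ : 0 < δ)
    {L x : ℕ → ℝ} (hL0 : ∀ n, 1 ≤ n → 0 ≤ L n) (hLm : ∀ m n, 1 ≤ m → m ≤ n → L m ≤ L n)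
    (hLlog : ∀ n : ℕ, 1 ≤ n → (1 + ε) * Real.logb 2 n ≤ L n)
    (hx : ∀ n, 1 ≤ n → x n ≤ 2 ^ (L n ^ α - θ * L n))
    (hge : ∀ᶠ N : ℕ in atTop, ENNReal.ofReal δ ≤ (∑' j : ℕ, ENNReal.ofReal (x (N + 1 + j))) *
      ENNReal.ofReal (2 ^ (M * (∑ n ∈ Finset.Icc 1 N, L n) + (N : ℝ) ^ 2 * L (N - 1) ^ c))) :
    ∃ S : ℝ, ∀ᶠ n in atTop, L n ≤ S * (M / θ + 1) ^ n := by
  have hθ0 : 0 < θ := lt_trans (by positivity) hθ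
  obtain ⟨η, C, hη, hC, htail⟩ := tsum_ofReal_tail_le hε hα hα1 hθ hL0 hLm hLlog hx
  have hK : 2 ≤ M / θ + 1 := by
    have : 1 ≤ M / θ := (one_le_div hθ0).2 (hθ1.trans hM)
    linarith
  refine exists_le_mul_pow_of_forall_record (D := max 1 (2 / η)) hK (le_max_left _ _) hL0 hLm ?_
  have hge' : ∀ᶠ t : ℕ in atTop, ENNReal.ofReal δ ≤
      (∑' j : ℕ, ENNReal.ofReal (x (t - 1 + 1 + j))) * ENNReal.ofReal
        (2 ^ (M * (∑ n ∈ Finset.Icc 1 (t - 1), L n) +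
          ((t - 1 : ℕ) : ℝ) ^ 2 * L (t - 1 - 1) ^ c)) :=
    (tendsto_sub_atTop_nat 1).eventually hge
  have hpow : ∀ᶠ t : ℕ in atTop, (t : ℝ) * (1 / 2 : ℝ) ^ t < δ / 2 := by
    have := tendsto_pow_const_mul_const_pow_of_abs_lt_one 1 (r := (1 / 2 : ℝ))
      (by norm_num [abs_lt])
    simp only [pow_one] at this
    exact this.eventually (gt_mem_nhds (half_pos hδ))
  have hexp : ∀ᶠ t : ℕ in atTop, Real.logb 2 (2 * C / δ) < (5 / 4 : ℝ) ^ t :=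
    (tendsto_pow_atTop_atTop_of_one_lt (by norm_num)).eventually_gt_atTop _
  filter_upwards [hge', hpow, hexp, eventually_slack_lt (M := M) hα1 hc1 hθ0,
    eventually_ge_atTop 3] with t hge hpow hexp hslack ht Y hqY hYL hle hsum
  by_contra! hbig
  have ht0 : (3 : ℝ) ≤ t := by exact_mod_cast ht
  have hq1 : (1 : ℝ) ≤ (5 / 4 : ℝ) ^ t := one_le_pow₀ (by norm_num)
  have hY1 : 1 ≤ Y := hq1.trans hqY
  have hY0 : 0 < Y := by linarith
  set u := ((5 / 4 : ℝ) ^ t) ^ (α - 1) with hu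
  set v := ((5 / 4 : ℝ) ^ t) ^ (c - 1) with hv
  set w := (4 / 5 : ℝ) ^ t with hw
  have hu0 : 0 < u := by positivity
  have hv0 : 0 < v := by positivity
  have hw0 : 0 < w := by positivity
  have hYu : Y ^ (α - 1) ≤ u := Real.rpow_le_rpow_of_nonpos (by positivity) hqY (by linarith)
  have hYv : Y ^ (c - 1) ≤ v := Real.rpow_le_rpow_of_nonpos (by positivity) hqY (by linarith)
  have hYα : Y ^ α ≤ u * Y := by
    have : Y ^ α = Y ^ (α - 1) * Y := by
      rw [← Real.rpow_add_one hY0.ne']; congr 1; ring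
    rw [this]
    gcongr
  have hYc : Y ^ c ≤ v * Y := by
    have : Y ^ c = Y ^ (c - 1) * Y := by
      rw [← Real.rpow_add_one hY0.ne']; congr 1; ring
    rw [this]
    gcongr
  have hwY : 1 ≤ w * Y := by
    have : w * (5 / 4 : ℝ) ^ t = 1 := by rw [hw, ← mul_pow]; norm_num
    nlinarith
  have hslack' : u + t ^ 2 * v + (M + t) * w < θ / t ^ 2 := by
    rw [lt_div_iff₀ (by positivity)]
    linarith
  have hθt : θ / (t : ℝ) ^ 2 ≤ θ := div_le_self hθ0.le (by nlinarith)
  have hYθ : Y ^ (α - 1) ≤ θ := by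
    have : 0 ≤ (t : ℝ) ^ 2 * v := by positivity
    have : 0 ≤ (M + t) * w := by positivity
    linarith
  rw [Nat.sub_add_cancel (by omega : 1 ≤ t)] at hge
  set E := M * (∑ n ∈ Finset.Icc 1 (t - 1), L n) + ((t - 1 : ℕ) : ℝ) ^ 2 * L (t - 1 - 1) ^ c
    with hE
  have hElt : E ≤ M * w * Y + θ * Y - θ / t ^ 2 * Y + t ^ 2 * v * Y := by
    have h1 : Finset.Icc 1 (t - 1) = Finset.Ico 1 t := by
      ext i; simp only [Finset.mem_Icc, Finset.mem_Ico]; omega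
    have h2 : M * ∑ n ∈ Finset.Icc 1 (t - 1), L n ≤ M * w * Y + θ * Y - θ / t ^ 2 * Y := by
      rw [h1]
      calc M * ∑ n ∈ Finset.Ico 1 t, L n
          ≤ M * (Y * (w + (1 - 1 / (t : ℝ) ^ 2) / (M / θ + 1 - 1))) := by gcongr
        _ = _ := by
          have : M ≠ 0 := by positivity
          rw [add_sub_cancel_right]
          field_simp
          ring
    have h3 : ((t - 1 : ℕ) : ℝ) ^ 2 * L (t - 1 - 1) ^ c ≤ t ^ 2 * (v * Y) := by
      have h4 : L (t - 1 - 1) ^ c ≤ v * Y :=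
        (Real.rpow_le_rpow (hL0 _ (by omega)) (hle _ (by omega) (by omega)) hc.le).trans hYc
      have h5 : ((t - 1 : ℕ) : ℝ) ≤ t := by exact_mod_cast Nat.sub_le t 1
      have h6 : 0 ≤ L (t - 1 - 1) ^ c := Real.rpow_nonneg (hL0 _ (by omega)) _
      gcongr
    rw [hE]
    linarith
  have hslackY := mul_lt_mul_of_pos_right hslack' hY0
  have htw : (t : ℝ) ≤ t * w * Y := by
    rw [mul_assoc]
    exact le_mul_of_one_le_right (by positivity) hwY
  have hfirst : E + (Y ^ α - θ * Y) ≤ -t := by linarith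
  have hsecond : E - η * L (2 * t) ≤ -Y := by
    have h1 : 2 * Y < η * L (2 * t) := by
      have h2 : 2 / η * Y < L (2 * t) := lt_of_le_of_lt (by gcongr; exact le_max_right _ _) hbig
      have h3 : η * (2 / η * Y) = 2 * Y := by field_simp
      rw [← h3]
      gcongr
    have h4 : 0 ≤ u * Y := by positivity
    have h5 : θ * Y ≤ 1 * Y := by gcongr
    linarith
  have hreal : δ ≤ (t * 2 ^ (Y ^ α - θ * Y) + C * 2 ^ (-(η * L (2 * t)))) * 2 ^ E := by
    have h1 := hge.trans (mul_le_mul_left (tsum_ofReal_le_of_tail hα1 hLm hx hC (by omega)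
      (htail (2 * t) (by omega)) hY0 hYL hYθ) _)
    rw [← ENNReal.ofReal_mul (by positivity)] at h1
    exact (ENNReal.ofReal_le_ofReal_iff (by positivity)).1 h1
  have h1 : (t : ℝ) * 2 ^ (Y ^ α - θ * Y) * 2 ^ E < δ / 2 := by
    rw [mul_assoc, ← Real.rpow_add (by norm_num)]
    refine lt_of_le_of_lt ?_ hpow
    have h2 : (1 / 2 : ℝ) ^ t = 2 ^ (-(t : ℝ)) := by
      rw [Real.rpow_neg (by norm_num), Real.rpow_natCast]; simp
    rw [h2]
    gcongr
    · norm_num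
    · linarith
  have h2 : C * 2 ^ (-(η * L (2 * t))) * 2 ^ E < δ / 2 := by
    rw [mul_assoc, ← Real.rpow_add (by norm_num)]
    have h3 : 2 * C / δ < 2 ^ Y :=
      (Real.logb_lt_iff_lt_rpow (by norm_num) (by positivity)).1 (hexp.trans_le hqY)
    have h4 : (2 : ℝ) ^ (-(η * L (2 * t)) + E) ≤ 2 ^ (-Y) :=
      Real.rpow_le_rpow_of_exponent_le (by norm_num) (by linarith)
    have h5 : C * (2 : ℝ) ^ (-Y) < δ / 2 := by
      rw [Real.rpow_neg (by norm_num), ← div_eq_mul_inv, div_lt_iff₀ (by positivity)]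
      rw [div_lt_iff₀ hδ] at h3
      linarith
    exact lt_of_le_of_lt (by gcongr) h5
  linarith

/-- (Lemma `ZnSmall`.) Under the growth hypotheses, the liminf of
`(Σ_{n=N+1}^∞ |b_n/a_n|) · (∏_{n=1}^N |a_n|^M) · 2^(N²(log₂|a_{N-1}|)^c)` is `0`
(the tail sum is taken in `ℝ≥0∞`, so a divergent tail is `+∞`). -/
theorem stmt_13 (ε α β M : ℝ) (hε : 0 < ε) (hα : 0 < α) (hα1 : α < 1) (hM : 1 ≤ M)
    (hβ : 0 ≤ β ∧ β < ε / (1 + ε))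
    (a b : ℕ → ℂ)
    (ha : ∀ n : ℕ, 1 ≤ n → (n : ℝ) ^ (1 + ε) ≤ ‖a n‖ ∧
      ‖a n‖ ≤ ‖a (n + 1)‖)
    (hb : ∀ n : ℕ, 1 ≤ n →
      ‖b n‖ < ‖a n‖ ^ β * 2 ^ (Real.logb 2 (‖a n‖) ^ α))
    (hlimsup : Filter.limsup (fun n : ℕ =>
      ((‖a n‖ ^ ((M / (1 - β) + 1) ^ (-(n : ℝ))) : ℝ) : EReal))
      Filter.atTop = ⊤) :
    ∀ c : ℝ, 0 < c → c < 1 →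
      Filter.liminf (fun N : ℕ =>
        (∑' j : ℕ, ENNReal.ofReal (‖b (N + 1 + j) / a (N + 1 + j)‖)) *
        ENNReal.ofReal (∏ n ∈ Finset.Icc 1 N, ‖a n‖ ^ M) *
        ENNReal.ofReal
          ((2 : ℝ) ^ ((N : ℝ) ^ 2 * Real.logb 2 (‖a (N - 1)‖) ^ c)))
        Filter.atTop = 0 := by
  intro c hc hc1
  by_contra hne
  obtain ⟨δ, hδ0, hδ⟩ := exists_between (pos_iff_ne_zero.2 hne)
  have hev := eventually_lt_of_lt_liminf hδ
  have hδtop : δ ≠ ⊤ := hδ.ne_top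
  have hA1 : ∀ n, 1 ≤ n → 1 ≤ ‖a n‖ := fun n hn =>
    le_trans (Real.one_le_rpow (by exact_mod_cast hn) (by linarith)) (ha n hn).1
  have hAL : ∀ n, 1 ≤ n → ‖a n‖ = 2 ^ Real.logb 2 ‖a n‖ := fun n hn =>
    (Real.rpow_logb (by norm_num) (by norm_num) (by linarith [hA1 n hn])).symm
  have hAm : ∀ m n, 1 ≤ m → m ≤ n → ‖a m‖ ≤ ‖a n‖ := by
    intro m n hm hmn
    induction n, hmn using Nat.le_induction with
    | base => exact le_rfl
    | succ k hk ih => exact ih.trans (ha k (hm.trans hk)).2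
  have hθ : 1 / (1 + ε) < 1 - β := by
    have : 1 / (1 + ε) = 1 - ε / (1 + ε) := by field_simp; ring
    linarith [hβ.2]
  have hθ0 : 0 < 1 - β := lt_trans (by positivity) hθ
  obtain ⟨S, hS⟩ := exists_le_mul_pow_of_tail_ge (L := fun n => Real.logb 2 ‖a n‖)
    (x := fun n => ‖b n / a n‖) (δ := δ.toReal) (c := c) hε hα hα1 hM hθ
    (by linarith [hβ.1]) hc hc1 (ENNReal.toReal_pos hδ0.ne' hδtop)
    (fun n hn => Real.logb_nonneg (by norm_num) (hA1 n hn))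
    (fun m n hm hmn => Real.logb_le_logb_of_le (by norm_num) (by linarith [hA1 m hm])
      (hAm m n hm hmn))
    (fun n hn => by
      have hn0 : (0 : ℝ) < n := by exact_mod_cast hn
      rw [← Real.logb_rpow_eq_mul_logb_of_pos hn0]
      exact Real.logb_le_logb_of_le (by norm_num) (by positivity) (ha n hn).1)
    (fun n hn => by
      have hpos : 0 < ‖a n‖ := by linarith [hA1 n hn]
      rw [norm_div, div_le_iff₀ hpos]
      refine (hb n hn).le.trans (le_of_eq ?_)
      nth_rewrite 1 5 [hAL n hn]
      rw [← Real.rpow_mul (by norm_num), ← Real.rpow_add (by norm_num),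
        ← Real.rpow_add (by norm_num)]
      congr 1
      ring)
    (by
      filter_upwards [hev] with N hN
      rw [ENNReal.ofReal_toReal hδtop]
      refine hN.le.trans (le_of_eq ?_)
      have hprod : ∏ n ∈ Finset.Icc 1 N, ‖a n‖ ^ M =
          2 ^ (M * ∑ n ∈ Finset.Icc 1 N, Real.logb 2 ‖a n‖) := by
        rw [Finset.mul_sum, Real.rpow_sum_of_pos (by norm_num)]
        refine Finset.prod_congr rfl fun n hn => ?_
        nth_rewrite 1 [hAL n (Finset.mem_Icc.1 hn).1]
        rw [← Real.rpow_mul (by norm_num), mul_comm]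
      rw [hprod, mul_assoc, ← ENNReal.ofReal_mul (by positivity), ← Real.rpow_add (by norm_num)])
  have hle : limsup (fun n : ℕ =>
      ((‖a n‖ ^ ((M / (1 - β) + 1) ^ (-(n : ℝ))) : ℝ) : EReal)) atTop ≤
        (((2 : ℝ) ^ S : ℝ) : EReal) := by
    refine limsup_le_of_le (by isBoundedDefault) ?_
    filter_upwards [hS, eventually_ge_atTop 1] with n hn hn1
    have hK : 0 < M / (1 - β) + 1 := by positivity
    refine EReal.coe_le_coe_iff.2 ?_
    nth_rewrite 1 [hAL n hn1]
    rw [← Real.rpow_mul (by norm_num)]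
    refine Real.rpow_le_rpow_of_exponent_le (by norm_num) ?_
    rw [Real.rpow_neg hK.le, Real.rpow_natCast, ← div_eq_mul_inv, div_le_iff₀ (by positivity)]
    exact hn
  rw [hlimsup, top_le_iff] at hle
  exact EReal.coe_ne_top _ hle
end

section
/- Let {a_n}_{n≥1} be a sequence of complex numbers such that the infinite product ∏_{n=1}^∞ (1 + a_n) converges (its partial products converge in ℂ) and the sequence of partial products ∏_{n=1}^N |1 + a_n| is monotone in N and converges to ∏_{n=1}^∞ |1 + a_n|. Then for every N ≥ 1, |∏_{n=1}^∞ (1 + a_n) − ∏_{n=1}^N (1 + a_n)| ≤ max{1, ∏_{n=1}^∞ |1 + a_n|} · Σ_{n=N+1}^∞ |a_n|. -/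
open Filter

/-- (Lemma `prod->sum`.) If `∏ (1 + a_n)` converges and the partial
products of `|1 + a_n|` are monotone (in either direction) and converge, then the
distance from the full product to the `N`-th partial product is at most
`max{1, ∏ |1 + a_n|} · Σ_{n=N+1}^∞ |a_n|` (in `ℝ≥0∞`, so a divergent tail sum
is `+∞` and the inequality is then trivial). -/
theorem stmt_15 (a : ℕ → ℂ) (L : ℂ) (P : ℝ)
    (hL : Tendsto (fun N => ∏ n ∈ Finset.Icc 1 N, (1 + a n)) atTop (nhds L))
    (hmono : Monotone (fun N => ∏ n ∈ Finset.Icc 1 N, ‖1 + a n‖) ∨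
      Antitone (fun N => ∏ n ∈ Finset.Icc 1 N, ‖1 + a n‖))
    (hP : Tendsto (fun N => ∏ n ∈ Finset.Icc 1 N, ‖1 + a n‖) atTop (nhds P)) :
    ∀ N : ℕ, 1 ≤ N →
      ENNReal.ofReal ‖L - ∏ n ∈ Finset.Icc 1 N, (1 + a n)‖ ≤
        ENNReal.ofReal (max 1 P) * ∑' j : ℕ, ENNReal.ofReal ‖a (N + 1 + j)‖ := by
  intro N _
  have hbound : ∀ n, ∏ k ∈ Finset.Icc 1 n, ‖1 + a k‖ ≤ max 1 P := by
    intro n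
    rcases hmono with hm | hm
    · exact (hm.ge_of_tendsto hP n).trans (le_max_right _ _)
    · exact (by simpa using hm (Nat.zero_le n) : _ ≤ (1 : ℝ)).trans (le_max_left _ _)
  have hstep : ∀ n, edist (∏ k ∈ Finset.Icc 1 n, (1 + a k))
      (∏ k ∈ Finset.Icc 1 n.succ, (1 + a k)) ≤
        ENNReal.ofReal (max 1 P) * ENNReal.ofReal ‖a (n + 1)‖ := by
    intro n
    rw [← ENNReal.ofReal_mul (zero_le_one.trans (le_max_left _ _)), edist_comm, edist_dist,
      dist_eq_norm, Nat.succ_eq_add_one, Finset.prod_Icc_succ_top (Nat.le_add_left 1 n),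
      mul_one_add, add_sub_cancel_left, norm_mul, norm_prod]
    gcongr
    exact hbound n
  have h := edist_le_tsum_of_edist_le_of_tendsto _ hstep hL N
  rw [edist_comm, edist_dist, dist_eq_norm, ENNReal.tsum_mul_left] at h
  simpa only [add_right_comm N] using h
end

section
/- Let a_1, …, a_d be algebraic numbers that are linearly independent over ℚ. Then there exists a constant C_2 > 0, depending only on a_1, …, a_d, such that for every tuple (c_1, …, c_d) ∈ ℚ^d with the c_i not all zero, house(c_1 a_1 + c_2 a_2 + ⋯ + c_d a_d) ≥ C_2 · max_{1≤i≤d} |c_i|. -/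
open Filter

/-- The house of an algebraic number: the maximum modulus of its conjugates. -/
noncomputable def house (a : ℂ) : ℝ :=
  sSup {r : ℝ | ∃ z : ℂ, Polynomial.aeval z (minpoly ℚ a) = 0 ∧ r = ‖z‖}

/-- The conjugates of an algebraic number are bounded by its house. -/
lemma norm_le_house {x z : ℂ} (hx : IsAlgebraic ℚ x)
    (hz : Polynomial.aeval z (minpoly ℚ x) = 0) : ‖z‖ ≤ house x := by
  have hfin : ((minpoly ℚ x).rootSet ℂ).Finite := Polynomial.rootSet_finite _ _
  refine le_csSup (((hfin.image norm).subset ?_).bddAbove) ⟨z, hz, rfl⟩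
  rintro r ⟨w, hw, rfl⟩
  exact ⟨w, Polynomial.mem_rootSet.mpr ⟨minpoly.ne_zero hx.isIntegral, hw⟩, rfl⟩

/-- Linearly independent families in a finite separable extension have a dual family with respect
to the trace form. -/
lemma LinearIndependent.exists_trace_dual {F K ι : Type*} [Field F] [Field K] [Algebra F K]
    [FiniteDimensional F K] [Algebra.IsSeparable F K] [Fintype ι] {b : ι → K}
    (hb : LinearIndependent F b) :
    ∃ β : ι → K, ∀ (c : ι → F) (j : ι), Algebra.trace F K (β j * ∑ i, c i • b i) = c j := by
  obtain ⟨g, hg⟩ := (Fintype.linearCombination F b).exists_leftInverse_of_injective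
    (LinearMap.ker_eq_bot.mpr (hb.fintypeLinearCombination_injective))
  refine ⟨fun j => ((Algebra.traceForm F K).toDual (traceForm_nondegenerate F K)).symm
    (LinearMap.proj j ∘ₗ g), fun c j => ?_⟩
  rw [← Algebra.traceForm_apply, LinearMap.BilinForm.apply_toDual_symm_apply]
  exact congrFun (LinearMap.congr_fun hg c) j

/-- (Second part of Lemma `houseOfSum`.) If `a_1, …, a_d` are
ℚ-linearly independent algebraic numbers, then there is `C₂ > 0` such that
`house(c_1 a_1 + ⋯ + c_d a_d) ≥ C₂ · max_i |c_i|` for all rational tuples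
`(c_1, …, c_d) ≠ 0` (stated equivalently for each coordinate `j`). -/
theorem stmt_16 (d : ℕ) (a : Fin d → ℂ)
    (halg : ∀ i, IsAlgebraic ℚ (a i))
    (hind : LinearIndependent ℚ a) :
    ∃ C₂ : ℝ, 0 < C₂ ∧ ∀ c : Fin d → ℚ, c ≠ 0 → ∀ j : Fin d,
      C₂ * |(c j : ℝ)| ≤ house (∑ i, (c i : ℂ) * a i) := by
  let K := IntermediateField.adjoin ℚ (Set.range a)
  have : FiniteDimensional ℚ K := by
    refine IntermediateField.finiteDimensional_adjoin ?_
    rintro _ ⟨i, rfl⟩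
    exact (halg i).isIntegral
  let b : Fin d → K := fun i => ⟨a i, IntermediateField.subset_adjoin ℚ _ ⟨i, rfl⟩⟩
  have hb : LinearIndependent ℚ b := LinearIndependent.of_comp K.val.toLinearMap hind
  obtain ⟨β, hβ⟩ := hb.exists_trace_dual
  let M : ℝ := ∑ j, ∑ σ : K →ₐ[ℚ] ℂ, ‖σ (β j)‖
  have hM : 0 ≤ M := by positivity
  refine ⟨(M + 1)⁻¹, by positivity, fun c _ j => ?_⟩
  let s : K := ∑ i, c i • b i
  have hs : (s : ℂ) = ∑ i, (c i : ℂ) * a i := by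
    simp [s, b, Algebra.smul_def]
  rw [← hs]
  have hsalg : IsAlgebraic ℚ (s : ℂ) :=
    (Algebra.IsAlgebraic.isAlgebraic (R := ℚ) s).algebraMap
  have hσ (σ : K →ₐ[ℚ] ℂ) : ‖σ s‖ ≤ house s := by
    refine norm_le_house hsalg ?_
    rw [show minpoly ℚ (s : ℂ) = minpoly ℚ s from
      minpoly.algHom_eq K.val K.val.injective s, Polynomial.aeval_algHom_apply, minpoly.aeval,
      map_zero]
  have hs0 : 0 ≤ house s := (norm_nonneg _).trans (hσ K.val)
  have hc : (c j : ℂ) = ∑ σ : K →ₐ[ℚ] ℂ, σ (β j) * σ s := by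
    have h := trace_eq_sum_embeddings (K := ℚ) ℂ (x := β j * s)
    rw [hβ c j] at h
    simpa using h
  rw [inv_mul_le_iff₀ (by positivity)]
  calc |(c j : ℝ)| = ‖(c j : ℂ)‖ := by simp
    _ ≤ ∑ σ : K →ₐ[ℚ] ℂ, ‖σ (β j)‖ * house s := by
      rw [hc]
      refine norm_sum_le_of_le _ fun σ _ => ?_
      rw [norm_mul]
      exact mul_le_mul_of_nonneg_left (hσ σ) (norm_nonneg _)
    _ = (∑ σ : K →ₐ[ℚ] ℂ, ‖σ (β j)‖) * house s := (Finset.sum_mul ..).symm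
    _ ≤ (M + 1) * house s := by
      gcongr
      exact (Finset.single_le_sum (f := fun j => ∑ σ : K →ₐ[ℚ] ℂ, ‖σ (β j)‖)
        (fun _ _ => by positivity) (Finset.mem_univ j)).trans (by simp [M])
end

section
/- Let K ⊆ ℂ be a number field of degree d over ℚ, and let α∈(0,1), δ, ε > 0, β∈[0, ε/(1+ε)), y ≥ β, z_1 ≥ −y, and z_2 > 0. Let {a_n}_{n≥1} and {b_n}_{n≥1} be sequences of nonzero elements of 𝒪_K such that for all n: (i) n^{1+ε} ≤ |a_n| ≤ |a_{n+1}|; (ii) |b_n| < |a_n|^β · 2^{(log₂|a_n|)^α}; (iii) house(b_n) ≤ |a_n|^{y} · 2^{(log₂|a_n|)^α}; (iv) house(a_n^{−1}) ≤ |a_n|^{z_1} · 2^{(log₂|a_n|)^α}; (v) there is a positive integer r_n dividing a_n in 𝒪_K with r_n · |norm(a_n/r_n)| ≤ |a_n|^{z_2} · 2^{(log₂|a_n|)^α}. Suppose limsup_{n→∞} |a_n|^{( (d(y + z_1 + z_2) + z_2 + δ)/(1−β) + 1 )^{−n}} = ∞, set M = d(y + z_1 + z_2) + z_2 + δ, and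 let x_1, …, x_d be a ℤ-module basis of 𝒪_K. Then there exist sequences of integers {p_{1,N}}, …, {p_{d,N}} and a sequence of positive integers {q_N} such that: q_N > 2^N and |p_{i,N}| ≤ 2^{N(log₂ q_N)^α} · q_N^{1 + (y+z_1)/z_2} for each i = 1, …, d and all sufficiently large N, while the inequality |∏_{n=1}^∞ (1 + b_n/a_n) − (Σ_{i=1}^d p_{i,N} x_i)/q_N| < 2^{−dN(log₂ q_N)^α} · q_N^{−M/z_2} holds for infinitely many N. -/
open Filter

/-- The product of the algebraic conjugates of `a`, i.e. the field norm of `a`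
from `ℚ(a)` to `ℚ` (viewed in `ℂ`). -/
noncomputable def conjNorm (a : ℂ) : ℂ :=
  ((minpoly ℚ a).aroots ℂ).prod

/-- Linear majorant of `x ^ α` with pivot `X`. -/
lemma rpow_le_pivot {α x X : ℝ} (hα0 : 0 < α) (hα1 : α < 1) (hx : 0 ≤ x) (hX : 0 < X) :
    x ^ α ≤ X ^ (α - 1) * (x + X) := by
  have e : X ^ (α - 1) * X = X ^ α := by
    rw [← Real.rpow_add_one hX.ne']; ring_nf
  rw [mul_add, e]
  rcases le_or_gt x X with h | h
  · have h1 : x ^ α ≤ X ^ α := Real.rpow_le_rpow hx h hα0.le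
    have h2 : 0 ≤ X ^ (α - 1) * x := by positivity
    linarith
  · have hx0 : 0 < x := hX.trans h
    have h1 : x ^ (α - 1) ≤ X ^ (α - 1) :=
      Real.rpow_le_rpow_of_nonpos hX h.le (by linarith)
    have h2 : x ^ α = x ^ (α - 1) * x := by
      rw [← Real.rpow_add_one hx0.ne']; ring_nf
    have h3 : 0 ≤ X ^ α := by positivity
    nlinarith

lemma rpow_le_geom {α T x : ℝ} (hα0 : 0 < α) (hα1 : α < 1) (hT : 1 < T) (hx : 0 ≤ x) (N : ℕ) :
    x ^ α ≤ ((T ^ ((α - 1) / 2)) ^ N) ^ 2 * (x + T ^ N) := by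
  have hT0 : 0 < T := by linarith
  have e : ((T ^ ((α - 1) / 2)) ^ N) ^ 2 = (T ^ N) ^ (α - 1) := by
    rw [← Real.rpow_natCast, ← Real.rpow_natCast, ← Real.rpow_natCast,
      ← Real.rpow_mul hT0.le, ← Real.rpow_mul hT0.le, ← Real.rpow_mul hT0.le]
    congr 1; push_cast; ring
  rw [e]
  exact rpow_le_pivot hα0 hα1 hx (by positivity)

/-- Growth estimate for a sequence of partial sums which never jumps on `[m, k)`. -/
lemma growth_of_no_jump {T σ : ℝ} (hT : 1 < T) (hσ0 : 0 < σ) (hσ1 : σ < 1) {S : ℕ → ℝ}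
    (hS : ∀ n, 0 ≤ S n) {m k : ℕ} (hmk : m ≤ k)
    (h : ∀ N, m ≤ N → N < k → S (N + 1) ≤ (T + σ ^ N) * S N + σ ^ N * T ^ N) :
    S k / T ^ k + 1 ≤ (S m / T ^ m + 1) * Real.exp (σ ^ m / (1 - σ)) := by
  have hT0 : 0 < T := by linarith
  have key : ∀ j, m + j ≤ k → S (m + j) / T ^ (m + j) + 1 ≤
      (S m / T ^ m + 1) * Real.exp (σ ^ m * (1 - σ ^ j) / (1 - σ)) := by
    intro j
    induction j with
    | zero => intro _; simp
    | succ j ih =>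
      intro hj
      have ih := ih (by omega)
      have hN := h (m + j) (by omega) (by omega)
      have hp : 0 < T ^ (m + j) := by positivity
      have hσp : 0 < σ ^ (m + j) := by positivity
      have hU : 0 ≤ S (m + j) / T ^ (m + j) := div_nonneg (hS _) hp.le
      have h1 : S (m + (j + 1)) / T ^ (m + (j + 1)) + 1 ≤
          (S (m + j) / T ^ (m + j) + 1) * (1 + σ ^ (m + j)) := by
        have e : S (m + j) = S (m + j) / T ^ (m + j) * T ^ (m + j) := by field_simp
        set U := S (m + j) / T ^ (m + j)
        rw [e] at hN
        have : S (m + (j + 1)) / T ^ (m + (j + 1)) ≤ U + σ ^ (m + j) * (U + 1) := by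
          rw [div_le_iff₀ (by positivity), ← add_assoc m j 1, pow_succ]
          refine hN.trans ?_
          have : 0 ≤ σ ^ (m + j) * (U + 1) * T ^ (m + j) * (T - 1) := by
            have : 0 ≤ T - 1 := by linarith
            positivity
          nlinarith
        linarith
      have h2 : 1 + σ ^ (m + j) ≤ Real.exp (σ ^ (m + j)) := by
        have := Real.add_one_le_exp (σ ^ (m + j)); linarith
      calc _ ≤ _ := h1
        _ ≤ ((S m / T ^ m + 1) * Real.exp (σ ^ m * (1 - σ ^ j) / (1 - σ))) *
            Real.exp (σ ^ (m + j)) :=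
          mul_le_mul ih h2 (by positivity) (le_trans (by positivity) ih)
        _ = _ := by
          rw [mul_assoc, ← Real.exp_add]
          congr 2
          have : 1 - σ ≠ 0 := by linarith
          field_simp
          ring
  have h1 := key (k - m) (by omega)
  rw [Nat.add_sub_cancel' hmk] at h1
  refine h1.trans ?_
  have : 0 ≤ S m / T ^ m := div_nonneg (hS _) (by positivity)
  have h1σ : 0 < 1 - σ := by linarith
  gcongr
  have : 0 < σ ^ m := by positivity
  have : 0 < σ ^ (k - m) := by positivity
  nlinarith

/-- A jump beats every sublinear error term. -/
lemma eventually_jump_bound {α T g M C D : ℝ} (hα0 : 0 < α) (hα1 : α < 1) (hT : 1 < T) (hg : 0 < g)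
    (hM : 0 ≤ M) (hC : 0 ≤ C) (hD : 0 ≤ D) :
    ∀ᶠ N : ℕ in atTop, ∀ S s : ℝ, 0 ≤ S →
      (M / g + (T ^ ((α - 1) / 2)) ^ N) * S + (T ^ ((α - 1) / 2)) ^ N * T ^ N ≤ s →
      M * S + D * N * S ^ α + D * N ≤ g * s - C * s ^ α := by
  have hT0 : 0 < T := by linarith
  set σ := T ^ ((α - 1) / 2) with hσ
  have hσ0 : 0 < σ := by positivity
  have hσ1 : σ < 1 := Real.rpow_lt_one_of_one_lt_of_neg hT (by linarith)
  have hσT : 1 < σ * T := by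
    have : σ * T = T ^ ((α - 1) / 2 + 1) := by rw [Real.rpow_add_one hT0.ne']
    rw [this]; exact Real.one_lt_rpow hT (by linarith)
  have l1 : Tendsto (fun N : ℕ => σ ^ N) atTop (nhds 0) :=
    tendsto_pow_atTop_nhds_zero_of_lt_one hσ0.le hσ1
  have l2 : Tendsto (fun N : ℕ => (N : ℝ) * σ ^ N) atTop (nhds 0) :=
    tendsto_self_mul_const_pow_of_lt_one hσ0.le hσ1
  have l3 : Tendsto (fun N : ℕ => (N : ℝ) * ((σ * T)⁻¹) ^ N) atTop (nhds 0) :=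
    tendsto_self_mul_const_pow_of_lt_one (by positivity) (inv_lt_one_of_one_lt₀ hσT)
  have e1 : ∀ᶠ N : ℕ in atTop, (C * (M / g + 1) + C) * σ ^ N + D * (N * σ ^ N) < g / 4 := by
    have := (l1.const_mul (C * (M / g + 1) + C)).add (l2.const_mul D)
    simp only [mul_zero, add_zero] at this
    exact this.eventually_lt_const (by positivity)
  have e2 : ∀ᶠ N : ℕ in atTop, D * (N * ((σ * T)⁻¹) ^ N) < g / 4 := by
    have := l3.const_mul D
    simp only [mul_zero] at this
    exact this.eventually_lt_const (by positivity)
  filter_upwards [e1, e2] with N h1 h2 S s hS hs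
  have p0 : 0 < σ ^ N := by positivity
  have p1 : σ ^ N ≤ 1 := pow_le_one₀ hσ0.le hσ1.le
  have pT : 0 < T ^ N := by positivity
  have hMg : 0 ≤ M / g := by positivity
  have hs0 : 0 ≤ s := le_trans (by positivity) hs
  have b1 := rpow_le_geom hα0 hα1 hT hs0 N
  have b2 := rpow_le_geom hα0 hα1 hT hS N
  rw [← hσ] at b1 b2
  have h3 : D * N < g / 4 * (σ ^ N * T ^ N) := by
    rw [inv_pow, mul_pow, ← mul_assoc, ← div_eq_mul_inv, div_lt_iff₀ (by positivity)] at h2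
    exact h2
  set p := σ ^ N
  set Q := T ^ N
  have hN : (0 : ℝ) ≤ N := Nat.cast_nonneg N
  have hDN : 0 ≤ D * N := by positivity
  have c1 : C * s ^ α ≤ C * (p ^ 2 * (s + Q)) := by gcongr
  have c2 : D * N * S ^ α ≤ D * N * (p ^ 2 * (S + Q)) := by gcongr
  have hpp : p ^ 2 ≤ p := by nlinarith
  have hCpp : C * p ^ 2 ≤ C * p := by gcongr
  have hCM : 0 ≤ C * p * (M / g) := by positivity
  have hCp : 0 ≤ C * p := by positivity
  have hDp : 0 ≤ D * N * p := by positivity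
  have h1' : C * p * (M / g) + 2 * (C * p) + D * N * p ≤ g / 4 := by linarith
  have hk : 0 ≤ g - C * p ^ 2 := by linarith
  have d1 : (g - C * p ^ 2) * ((M / g + p) * S + p * Q) ≤ (g - C * p ^ 2) * s := by gcongr
  have egM : g * (M / g) = M := by field_simp
  have d2 : (M + D * N * p ^ 2) * S ≤ (g - C * p ^ 2) * (M / g + p) * S := by
    refine mul_le_mul_of_nonneg_right ?_ hS
    have e : (g - C * p ^ 2) * (M / g + p) = M + p * (g - C * p * (M / g) - C * p ^ 2) := by
      linear_combination egM
    have h5 : p * (D * N * p) ≤ p * (g - C * p * (M / g) - C * p ^ 2) :=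
      mul_le_mul_of_nonneg_left (by linarith) p0.le
    rw [e]
    linarith
  have d3 : C * p ^ 2 * Q + D * N * p ^ 2 * Q + D * N ≤ (g - C * p ^ 2) * (p * Q) := by
    have h5 : (C * p + D * N * p + C * p ^ 2 + g / 4) * (p * Q) ≤ g * (p * Q) :=
      mul_le_mul_of_nonneg_right (by linarith) (by positivity)
    linarith
  linarith

/-- A bound for the partial sums below a geometric sequence makes the error terms negligible. -/
lemma eventually_error_le {α T M h D η : ℝ} (hα0 : 0 < α) (hα1 : α < 1) (hT : 1 < T)
    (hM : 0 ≤ M) (hh : 0 < h) (hD : 0 ≤ D) (_ : 0 ≤ η) (hη' : M * η ≤ h / 2) :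
    ∀ᶠ N : ℕ in atTop, ∀ S : ℝ, 0 ≤ S → S ≤ η * T ^ N →
      M * S + D * N * S ^ α + D * N ≤ h * T ^ N := by
  have hT0 : 0 < T := by linarith
  set σ := T ^ ((α - 1) / 2) with hσ
  have hσ0 : 0 < σ := by positivity
  have hσ1 : σ < 1 := Real.rpow_lt_one_of_one_lt_of_neg hT (by linarith)
  have l2 : Tendsto (fun N : ℕ => (N : ℝ) * σ ^ N) atTop (nhds 0) :=
    tendsto_self_mul_const_pow_of_lt_one hσ0.le hσ1
  have l3 : Tendsto (fun N : ℕ => (N : ℝ) * (T⁻¹) ^ N) atTop (nhds 0) :=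
    tendsto_self_mul_const_pow_of_lt_one (by positivity) (inv_lt_one_of_one_lt₀ hT)
  have e1 : ∀ᶠ N : ℕ in atTop, D * (1 + η) * (N * σ ^ N) < h / 4 := by
    have := l2.const_mul (D * (1 + η))
    simp only [mul_zero] at this
    exact this.eventually_lt_const (by positivity)
  have e2 : ∀ᶠ N : ℕ in atTop, D * (N * (T⁻¹) ^ N) < h / 4 := by
    have := l3.const_mul D
    simp only [mul_zero] at this
    exact this.eventually_lt_const (by positivity)
  filter_upwards [e1, e2] with N h1 h2 S hS hSη
  have p0 : 0 < σ ^ N := by positivity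
  have p1 : σ ^ N ≤ 1 := pow_le_one₀ hσ0.le hσ1.le
  have pT : 0 < T ^ N := by positivity
  have b2 := rpow_le_geom hα0 hα1 hT hS N
  rw [← hσ] at b2
  have h3 : D * N < h / 4 * T ^ N := by
    rw [inv_pow, ← mul_assoc, ← div_eq_mul_inv, div_lt_iff₀ (by positivity)] at h2
    exact h2
  set p := σ ^ N
  set Q := T ^ N
  have hpp : p ^ 2 ≤ p := by nlinarith
  have c2 : D * N * S ^ α ≤ D * N * (p * ((1 + η) * Q)) := by
    gcongr
    refine b2.trans ?_
    gcongr
    linarith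
  have c3 : D * (1 + η) * (N * p) * Q ≤ h / 4 * Q := by gcongr
  have c4 : M * S ≤ M * (η * Q) := by gcongr
  have c5 : M * η * Q ≤ h / 2 * Q := by gcongr
  linarith

/-- If `s n / T ^ n` is unbounded, then infinitely often `s (N + 1)` jumps above the preceding
partial sum, while every later term is either at least linear or far above that partial sum. -/
lemma frequently_jump {α T g M h D : ℝ} (hα0 : 0 < α) (hα1 : α < 1) (hg : 0 < g) (hM : 0 < M)
    (hh : 0 < h) (hD : 0 ≤ D) (hT : T = M / g + 1) {s : ℕ → ℝ} (hmono : Monotone s)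
    (hs0 : ∀ n, 0 ≤ s n) (hsup : ∀ B : ℝ, ∃ᶠ n in atTop, B * T ^ n < s n) {S : ℕ → ℝ}
    (hSdef : ∀ N, S N = ∑ n ∈ Finset.Icc 1 N, s n) :
    ∃ᶠ N : ℕ in atTop,
      ((M / g + (T ^ ((α - 1) / 2)) ^ N) * S N + (T ^ ((α - 1) / 2)) ^ N * T ^ N ≤ s (N + 1)) ∧
      ∀ n, N < n → (n : ℝ) ≤ s n ∨ M * S N + D * N * S N ^ α + D * N ≤ h * s n := by
  have hMg : 0 < M / g := by positivity
  have hT1 : 1 < T := by linarith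
  have hT0 : 0 < T := by linarith
  have hS : ∀ N, 0 ≤ S N := fun N => by rw [hSdef]; exact Finset.sum_nonneg fun n _ => hs0 n
  have hSs : ∀ N, S (N + 1) = S N + s (N + 1) := fun N => by
    rw [hSdef, hSdef, Finset.sum_Icc_succ_top (by omega)]
  have hsS : ∀ n, 1 ≤ n → s n ≤ S n := fun n hn => by
    obtain ⟨k, rfl⟩ : ∃ k, n = k + 1 := ⟨n - 1, by omega⟩
    rw [hSs]; linarith [hS k]
  set σ := T ^ ((α - 1) / 2) with hσ
  have hσ0 : 0 < σ := by positivity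
  have hσ1 : σ < 1 := Real.rpow_lt_one_of_one_lt_of_neg hT1 (by linarith)
  have hnj : ∀ N, ¬ ((M / g + σ ^ N) * S N + σ ^ N * T ^ N ≤ s (N + 1)) →
      S (N + 1) ≤ (T + σ ^ N) * S N + σ ^ N * T ^ N := by
    intro N hN
    rw [hSs, hT]
    push Not at hN
    rw [hT] at hN
    linarith
  by_cases hcase : ∀ᶠ n : ℕ in atTop, (n : ℝ) ≤ s n
  · obtain ⟨n0, hn0⟩ := eventually_atTop.1 hcase
    by_contra hcon
    rw [not_frequently] at hcon
    obtain ⟨n1, hn1⟩ := eventually_atTop.1 hcon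
    set m := max (max n0 n1) 1
    have hgr : ∀ k, m ≤ k → s k ≤
        (S m / T ^ m + 1) * Real.exp (σ ^ m / (1 - σ)) * T ^ k := by
      intro k hk
      have := growth_of_no_jump hT1 hσ0 hσ1 hS hk (fun N hmN _ => hnj N fun hj =>
        hn1 N (by omega) ⟨hj, fun n hn => Or.inl (hn0 n (by omega))⟩)
      have h2 : S k / T ^ k ≤ (S m / T ^ m + 1) * Real.exp (σ ^ m / (1 - σ)) := by linarith
      rw [div_le_iff₀ (by positivity)] at h2
      exact (hsS k (by omega)).trans h2
    have := (hsup ((S m / T ^ m + 1) * Real.exp (σ ^ m / (1 - σ)))).and_eventually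
      (eventually_ge_atTop m)
    obtain ⟨k, hk1, hk2⟩ := this.exists
    exact absurd (hgr k hk2) (not_le.2 hk1)
  · rw [not_eventually] at hcase
    set η := min (h / (2 * M)) (1 / 2) with hη
    have hη0 : 0 < η := by positivity
    have hηM : M * η ≤ h / 2 := by
      calc M * η ≤ M * (h / (2 * M)) := by gcongr; exact min_le_left _ _
        _ = h / 2 := by field_simp
    have herr := eventually_error_le hα0 hα1 hT1 hM.le hh hD hη0.le hηM
    have l1 : Tendsto (fun m : ℕ => ((m : ℝ) ^ 2 / T ^ m + 1) * Real.exp (σ ^ m / (1 - σ)))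
        atTop (nhds 1) := by
      have t1 : Tendsto (fun m : ℕ => (m : ℝ) ^ 2 / T ^ m) atTop (nhds 0) :=
        tendsto_pow_const_div_const_pow_of_one_lt 2 hT1
      have t2 : Tendsto (fun m : ℕ => σ ^ m / (1 - σ)) atTop (nhds 0) := by
        simpa using (tendsto_pow_atTop_nhds_zero_of_lt_one hσ0.le hσ1).div_const (1 - σ)
      have t3 := (Real.continuous_exp.tendsto 0).comp t2
      have := (t1.add_const 1).mul t3
      simpa using this
    have l2 := l1.eventually_lt_const (show (1 : ℝ) < 1 + η by linarith)
    obtain ⟨n0, hn0⟩ := eventually_atTop.1 (herr.and l2)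
    rw [frequently_atTop]
    intro N0
    obtain ⟨m1, hm1, hm1'⟩ := frequently_atTop.1 hcase (max (max n0 N0) 1)
    obtain ⟨k, hk, hk'⟩ := frequently_atTop.1 (hsup 1) (m1 + 1)
    have hP : ¬ ((m1 : ℝ) ≤ s m1) := hm1'
    set m := Nat.findGreatest (fun n => ¬ ((n : ℝ) ≤ s n)) (k - 1) with hmdef
    have hmm1 : m1 ≤ m := Nat.le_findGreatest (by omega) hP
    have hmk : m ≤ k - 1 := Nat.findGreatest_le _
    have hmP : ¬ ((m : ℝ) ≤ s m) :=
      Nat.findGreatest_spec (P := fun n => ¬ ((n : ℝ) ≤ s n)) (show m1 ≤ k - 1 by omega) hP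
    have hmid : ∀ n, m < n → n < k → (n : ℝ) ≤ s n := by
      intro n h1 h2
      by_contra h3
      exact absurd (Nat.le_findGreatest (P := fun n => ¬ ((n : ℝ) ≤ s n))
        (show n ≤ k - 1 by omega) h3) (by omega)
    have hSm : S m ≤ (m : ℝ) ^ 2 := by
      rw [hSdef]
      calc ∑ n ∈ Finset.Icc 1 m, s n ≤ ∑ n ∈ Finset.Icc 1 m, (m : ℝ) := by
            refine Finset.sum_le_sum fun n hn => ?_
            exact (hmono (Finset.mem_Icc.1 hn).2).trans (not_le.1 hmP).le
        _ = (m : ℝ) ^ 2 := by simp; ring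
    have hsmall : ∀ j, m ≤ j → (∀ N, m ≤ N → N < j →
        ¬ ((M / g + σ ^ N) * S N + σ ^ N * T ^ N ≤ s (N + 1))) → S j ≤ η * T ^ j := by
      intro j hj hno
      have h1 := growth_of_no_jump hT1 hσ0 hσ1 hS hj (fun N a b => hnj N (hno N a b))
      have h2 := (hn0 m (by omega)).2
      have h3 : (S m / T ^ m + 1) * Real.exp (σ ^ m / (1 - σ)) ≤
          ((m : ℝ) ^ 2 / T ^ m + 1) * Real.exp (σ ^ m / (1 - σ)) := by gcongr
      have h4 : S j / T ^ j ≤ η := by linarith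
      rwa [div_le_iff₀ (by positivity)] at h4
    have hex : ∃ N, m ≤ N ∧ N < k ∧ (M / g + σ ^ N) * S N + σ ^ N * T ^ N ≤ s (N + 1) := by
      by_contra hcon
      push Not at hcon
      have h1 := hsmall k (by omega) (fun N a b => not_le.2 (hcon N a b))
      have h2 := hsS k (by omega)
      have h3 : η ≤ 1 / 2 := min_le_right _ _
      have h4 : 0 < T ^ k := by positivity
      nlinarith
    classical
    obtain ⟨hN1, hN2, hN3⟩ := Nat.find_spec hex
    have hmin := fun j (hj : j < Nat.find hex) => Nat.find_min hex hj
    set N := Nat.find hex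
    refine ⟨N, by omega, hN3, fun n hn => ?_⟩
    rcases lt_or_ge n k with h1 | h1
    · exact Or.inl (hmid n (by omega) h1)
    · right
      have h2 := hsmall N hN1 (fun j a b hj => hmin j b ⟨a, by omega, hj⟩)
      refine ((hn0 N (by omega)).1 (S N) (hS N) h2).trans ?_
      have h3 : T ^ N ≤ T ^ k := pow_le_pow_right₀ hT1.le (by omega)
      have h4 := hmono h1
      gcongr
      linarith

lemma rpow_le_linear {α h : ℝ} (hα0 : 0 < α) (hα1 : α < 1) (hh : 0 < h) :
    ∃ C : ℝ, ∀ s : ℝ, 0 ≤ s → s ^ α ≤ h * s + C := by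
  have hX : 0 < h ^ (1 / (α - 1)) := by positivity
  refine ⟨h * h ^ (1 / (α - 1)), fun s hs => ?_⟩
  have := rpow_le_pivot hα0 hα1 hs hX
  rw [← Real.rpow_mul hh.le, one_div_mul_cancel (by linarith), Real.rpow_one] at this
  linarith

/-- Infinitely many tails of the series are small compared with the preceding partial sums of
exponents. -/
theorem tail_bound {α g ε M : ℝ} (hα0 : 0 < α) (hα1 : α < 1) (hg : 0 < g) (hε : 0 < ε)
    (hM : 0 < M) (hgε : 1 < g * (1 + ε)) {s : ℕ → ℝ} (hmono : Monotone s)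
    (hs0 : ∀ n, 0 ≤ s n) (hlog : ∀ n : ℕ, (1 + ε) * Real.logb 2 n ≤ s n)
    (hsup : ∀ B : ℝ, ∃ᶠ n in atTop, B * (M / g + 1) ^ n < s n) {S : ℕ → ℝ}
    (hSdef : ∀ N, S N = ∑ n ∈ Finset.Icc 1 N, s n) :
    Summable (fun n => (2 : ℝ) ^ (-(g * s n) + s n ^ α)) ∧
    ∃ C : ℝ, ∀ D : ℝ, 0 ≤ D → ∃ᶠ N : ℕ in atTop,
      ∑' j, (2 : ℝ) ^ (-(g * s (N + 1 + j)) + s (N + 1 + j) ^ α) ≤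
        C * 2 ^ (-(M * S N + D * N * S N ^ α + D * N)) := by
  set h := (g * (1 + ε) - 1) / (4 * (1 + ε)) with hhdef
  have hh : 0 < h := div_pos (by linarith) (by linarith)
  set ν := (g * (1 + ε) - 1) / 2 with hν
  have hν0 : 0 < ν := by rw [hν]; linarith
  have hgh : (g - 2 * h) * (1 + ε) = 1 + ν := by rw [hhdef, hν]; field_simp; ring
  have hgh0 : 0 < g - 2 * h := by
    by_contra hc
    nlinarith
  obtain ⟨C0, hC0⟩ := rpow_le_linear hα0 hα1 hh
  have hB : ∀ n : ℕ, -(g * s n) + s n ^ α ≤ C0 - h * s n - (1 + ν) * Real.logb 2 n := by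
    intro n
    have h1 := hC0 (s n) (hs0 n)
    have h2 := mul_le_mul_of_nonneg_left (hlog n) hgh0.le
    rw [← mul_assoc, hgh] at h2
    linarith
  have hconv : ∀ n : ℕ, 1 ≤ n → ∀ c : ℝ, (2 : ℝ) ^ (-(c * Real.logb 2 n)) = 1 / (n : ℝ) ^ c := by
    intro n hn c
    have hn' : (0 : ℝ) < n := by exact_mod_cast hn
    rw [show -(c * Real.logb 2 n) = Real.logb 2 n * (-c) by ring, Real.rpow_mul (by norm_num),
      Real.rpow_logb (by norm_num) (by norm_num) hn', Real.rpow_neg hn'.le, one_div]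
  set G : ℕ → ℝ := fun n => 1 / (n : ℝ) ^ (2 : ℝ) + 2 ^ C0 * (1 / (n : ℝ) ^ (1 + ν)) with hG
  have hGs : Summable G :=
    (Real.summable_one_div_nat_rpow.2 (by norm_num)).add
      ((Real.summable_one_div_nat_rpow.2 (by linarith)).mul_left _)
  have hG0 : ∀ n, 0 ≤ G n := fun n => by positivity
  have hBG : ∀ n : ℕ, 1 ≤ n → ∀ E : ℝ, E ≤ h * s n →
      (2 : ℝ) ^ (-(g * s n) + s n ^ α) ≤ G n * 2 ^ (-E) := by
    intro n hn E hE
    calc (2 : ℝ) ^ (-(g * s n) + s n ^ α) ≤ 2 ^ (C0 + -((1 + ν) * Real.logb 2 n) + -E) := by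
          apply Real.rpow_le_rpow_of_exponent_le (by norm_num)
          linarith [hB n]
      _ = 2 ^ C0 * (1 / (n : ℝ) ^ (1 + ν)) * 2 ^ (-E) := by
          rw [Real.rpow_add (by norm_num), Real.rpow_add (by norm_num), hconv n hn]
      _ ≤ _ := by
          gcongr
          simp only [hG]
          have : 0 ≤ 1 / (n : ℝ) ^ (2 : ℝ) := by positivity
          linarith
  have hsum : Summable (fun n => (2 : ℝ) ^ (-(g * s n) + s n ^ α)) := by
    rw [← summable_nat_add_iff 1]
    refine Summable.of_nonneg_of_le (fun n => by positivity) (fun n => ?_)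
      ((summable_nat_add_iff 1).2 hGs)
    have := hBG (n + 1) (by omega) 0 (by have := hs0 (n + 1); positivity)
    simpa using this
  refine ⟨hsum, ∑' n, G n, fun D hD => ?_⟩
  have hMg : 0 < M / g := by positivity
  have hA := eventually_jump_bound (C := 2 / (α * Real.log 2) + 1) hα0 hα1
    (show 1 < M / g + 1 by linarith) hg hM.le
    (by have := Real.log_pos (show (1 : ℝ) < 2 by norm_num); positivity) hD
  have hJ := frequently_jump hα0 hα1 hg hM hh hD rfl hmono hs0 hsup hSdef
  refine (hJ.and_eventually hA).mono ?_
  rintro N ⟨⟨hj, hn⟩, hA⟩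
  have hS : 0 ≤ S N := by rw [hSdef]; exact Finset.sum_nonneg fun n _ => hs0 n
  set E := M * S N + D * N * S N ^ α + D * N with hE
  have hpt : ∀ n, N < n → (2 : ℝ) ^ (-(g * s n) + s n ^ α) ≤ G n * 2 ^ (-E) := by
    intro n hNn
    rcases hn n hNn with h1 | h1
    · have h2 := hA (S N) (s n) hS (hj.trans (hmono hNn))
      have hn' : (0 : ℝ) < n := by exact_mod_cast (by omega : 0 < n)
      have h3 : 2 * Real.logb 2 n ≤ 2 / (α * Real.log 2) * s n ^ α := by
        have hl2 := Real.log_pos (show (1 : ℝ) < 2 by norm_num)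
        have a1 := Real.log_le_rpow_div hn'.le hα0
        have a2 : (n : ℝ) ^ α ≤ s n ^ α := Real.rpow_le_rpow hn'.le h1 hα0.le
        have a3 : Real.log n ≤ s n ^ α / α := a1.trans (by gcongr)
        calc 2 * Real.logb 2 n = 2 * (Real.log n / Real.log 2) := rfl
          _ ≤ 2 * (s n ^ α / α / Real.log 2) := by gcongr
          _ = _ := by field_simp
      calc (2 : ℝ) ^ (-(g * s n) + s n ^ α) ≤ 2 ^ (-(2 * Real.logb 2 n) + -E) := by
            apply Real.rpow_le_rpow_of_exponent_le (by norm_num)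
            linarith
        _ = (1 / (n : ℝ) ^ (2 : ℝ)) * 2 ^ (-E) := by
            rw [Real.rpow_add (by norm_num), hconv n (by omega)]
        _ ≤ _ := by
            gcongr
            simp only [hG]
            have : 0 ≤ 2 ^ C0 * (1 / (n : ℝ) ^ (1 + ν)) := by positivity
            linarith
    · exact hBG n (by omega) E h1
  have hinj : Function.Injective (fun j : ℕ => N + 1 + j) := add_right_injective _
  have hsG : Summable (fun j => G (N + 1 + j)) := hGs.comp_injective hinj
  calc _ ≤ ∑' j, G (N + 1 + j) * 2 ^ (-E) :=
        Summable.tsum_le_tsum (fun j => hpt _ (by omega)) (hsum.comp_injective hinj)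
          (hsG.mul_right _)
    _ = (∑' j, G (N + 1 + j)) * 2 ^ (-E) := tsum_mul_right
    _ ≤ _ :=
      mul_le_mul_of_nonneg_right (tsum_comp_le_tsum_of_inj hGs hG0 hinj) (by positivity)

lemma norm_algHom_le_house (K : IntermediateField ℚ ℂ) [FiniteDimensional ℚ K] (σ : K →ₐ[ℚ] ℂ)
    (b : K) : ‖σ b‖ ≤ house (b : ℂ) := by
  have hb : IsIntegral ℚ b := IsIntegral.of_finite ℚ b
  have hmin : minpoly ℚ (b : ℂ) = minpoly ℚ b :=
    minpoly.algHom_eq K.val K.val.injective b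
  have hset : {r : ℝ | ∃ z : ℂ, Polynomial.aeval z (minpoly ℚ (b : ℂ)) = 0 ∧ r = ‖z‖} =
      (fun z : ℂ => ‖z‖) '' ((minpoly ℚ b).rootSet ℂ) := by
    ext r
    simp only [Set.mem_ofPred_eq, Set.mem_image, Polynomial.mem_rootSet, hmin]
    exact ⟨fun ⟨z, h1, h2⟩ => ⟨z, ⟨minpoly.ne_zero hb, h1⟩, h2.symm⟩,
      fun ⟨z, ⟨_, h1⟩, h2⟩ => ⟨z, h1, h2.symm⟩⟩
  unfold house
  rw [hset]
  refine le_csSup (((minpoly ℚ b).rootSet_finite ℂ).image _).bddAbove ⟨σ b, ?_, rfl⟩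
  rw [Polynomial.mem_rootSet]
  exact ⟨minpoly.ne_zero hb, by rw [Polynomial.aeval_algHom_apply, minpoly.aeval, map_zero]⟩

/-- The norm of an integral element is a positive multiple of it in the ring of integers. -/
lemma exists_mul_eq_conjNorm (K : IntermediateField ℚ ℂ) {t : ℂ} (htK : t ∈ K)
    (ht : IsIntegral ℤ t) (ht0 : t ≠ 0) :
    ∃ c : ℕ, 0 < c ∧ (c : ℝ) = ‖conjNorm t‖ ∧ ∃ u : ℂ, u ∈ K ∧ IsIntegral ℤ u ∧ t * u = c := by
  have hmin := minpoly.isIntegrallyClosed_eq_field_fractions' ℚ ht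
  have htQ : IsIntegral ℚ t := ht.tower_top
  set c0 : ℤ := (minpoly ℤ t).coeff 0 with hc0
  have hcoe : (minpoly ℚ t).coeff 0 = (c0 : ℚ) := by
    rw [hmin, Polynomial.coeff_map]; simp [hc0]
  have hc0' : c0 ≠ 0 := by
    intro h
    have := minpoly.coeff_zero_ne_zero htQ ht0
    rw [hcoe, h] at this
    simp at this
  have hnorm : ‖conjNorm t‖ = |(c0 : ℝ)| := by
    have h1 := Polynomial.Splits.coeff_zero_eq_prod_roots_of_monic
      (IsAlgClosed.splits ((minpoly ℚ t).map (algebraMap ℚ ℂ))) ((minpoly.monic htQ).map _)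
    rw [Polynomial.coeff_map, hcoe] at h1
    have h2 := congrArg norm h1
    rw [norm_mul, norm_pow, norm_neg, norm_one, one_pow, one_mul] at h2
    unfold conjNorm
    rw [Polynomial.aroots, ← h2]
    simp
  have hu : t * Polynomial.aeval t (minpoly ℤ t).divX = -(c0 : ℂ) := by
    have h1 := congrArg (Polynomial.aeval t) (minpoly ℤ t).divX_mul_X_add
    rw [minpoly.aeval, map_add, map_mul, Polynomial.aeval_X, Polynomial.aeval_C] at h1
    simp only [← hc0, eq_intCast] at h1
    linear_combination h1
  have huI : IsIntegral ℤ (Polynomial.aeval t (minpoly ℤ t).divX) := by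
    have : Polynomial.aeval t (minpoly ℤ t).divX ∈ Algebra.adjoin ℤ {t} :=
      Polynomial.aeval_mem_adjoin_singleton ℤ t
    exact IsIntegral.of_mem_of_fg _ ht.fg_adjoin_singleton _ this
  have huK : Polynomial.aeval t (minpoly ℤ t).divX ∈ K := by
    rw [show Polynomial.aeval t (minpoly ℤ t).divX = -(c0 : ℂ) * t⁻¹ by
      rw [← hu]; field_simp]
    exact mul_mem (neg_mem (intCast_mem K c0)) (inv_mem htK)
  refine ⟨c0.natAbs, Int.natAbs_pos.2 hc0', by rw [hnorm, Nat.cast_natAbs, Int.cast_abs], ?_⟩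
  rcases Int.natAbs_eq c0 with h | h
  · refine ⟨-_, neg_mem huK, huI.neg, ?_⟩
    rw [mul_neg, hu, neg_neg]
    conv_lhs => rw [h]
    simp
  · refine ⟨_, huK, huI, ?_⟩
    rw [hu]
    conv_lhs => rw [h]
    simp

/-- Integer coordinates are bounded by a constant times the largest conjugate. -/
lemma exists_coord_bound (K : IntermediateField ℚ ℂ) [FiniteDimensional ℚ K] {d : ℕ}
    (hd : Module.finrank ℚ K = d) (x : Fin d → ℂ) (hxK : ∀ i, x i ∈ K)
    (hxind : LinearIndependent ℤ x) :
    ∃ C : ℝ, 0 < C ∧ ∀ (m : Fin d → ℤ) (t : K), (t : ℂ) = ∑ i, (m i : ℂ) * x i → ∀ B : ℝ,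
      (∀ σ : K →ₐ[ℚ] ℂ, ‖σ t‖ ≤ B) → ∀ i, |(m i : ℝ)| ≤ C * B := by
  classical
  have hdpos : 0 < d := hd ▸ Module.finrank_pos
  have : Nonempty (Fin d) := ⟨⟨0, hdpos⟩⟩
  set x' : Fin d → K := fun i => ⟨x i, hxK i⟩
  have hind : LinearIndependent ℚ x' := by
    have h1 : LinearIndependent ℚ x := (LinearIndependent.iff_fractionRing ℤ ℚ).1 hxind
    exact LinearIndependent.of_comp K.val.toLinearMap h1
  set bs := basisOfLinearIndependentOfCardEqFinrank hind (by simp [hd])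
  have hbs : ∀ i, bs i = x' i := fun i => by simp [bs]
  set dual := (Algebra.traceForm ℚ K).dualBasis (traceForm_nondegenerate ℚ K) bs
  refine ⟨1 + ∑ i, ∑ σ : K →ₐ[ℚ] ℂ, ‖σ (dual i)‖, ?_, ?_⟩
  · have : 0 ≤ ∑ i, ∑ σ : K →ₐ[ℚ] ℂ, ‖σ (dual i)‖ := by positivity
    linarith
  intro m t ht B hB i
  have ht' : t = ∑ j, (m j : ℚ) • bs j := by
    apply Subtype.ext
    rw [ht]
    simp only [hbs]
    rw [AddSubmonoidClass.coe_finsetSum]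
    refine Finset.sum_congr rfl fun j _ => ?_
    simp [x', Algebra.smul_def]
  have htr : Algebra.trace ℚ K (dual i * t) = m i := by
    have h1 : Algebra.traceForm ℚ K (dual i) t = m i := by
      rw [ht', map_sum]
      simp only [map_smul, dual, LinearMap.BilinForm.apply_dualBasis_left]
      simp
    simpa [Algebra.traceForm_apply] using h1
  have hemb := trace_eq_sum_embeddings ℂ (K := ℚ) (x := dual i * t)
  rw [htr] at hemb
  have hB0 : 0 ≤ B := (norm_nonneg _).trans (hB K.val)
  have h2 : |(m i : ℝ)| = ‖∑ σ : K →ₐ[ℚ] ℂ, σ (dual i * t)‖ := by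
    rw [← hemb]; simp
  rw [h2]
  calc ‖∑ σ : K →ₐ[ℚ] ℂ, σ (dual i * t)‖ ≤ ∑ σ : K →ₐ[ℚ] ℂ, ‖σ (dual i * t)‖ := norm_sum_le _ _
    _ ≤ ∑ σ : K →ₐ[ℚ] ℂ, ‖σ (dual i)‖ * B := by
        refine Finset.sum_le_sum fun σ _ => ?_
        rw [map_mul, norm_mul]
        exact mul_le_mul_of_nonneg_left (hB σ) (norm_nonneg _)
    _ = (∑ σ : K →ₐ[ℚ] ℂ, ‖σ (dual i)‖) * B := by rw [Finset.sum_mul]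
    _ ≤ _ := by
        gcongr
        have := Finset.single_le_sum (f := fun i => ∑ σ : K →ₐ[ℚ] ℂ, ‖σ (dual i)‖)
          (fun i _ => by positivity) (Finset.mem_univ i)
        linarith

/-- Convergence of an infinite product together with a bound for its remainders. -/
lemma exists_prod_limit {f : ℕ → ℂ} {t : ℕ → ℝ} (ht : Summable t)
    (hf : ∀ n, 1 ≤ n → ‖f n‖ ≤ t n) :
    ∃ L : ℂ, Tendsto (fun N => ∏ n ∈ Finset.Icc 1 N, (1 + f n)) atTop (nhds L) ∧
      ∃ C : ℝ, 0 < C ∧ ∀ N : ℕ, ∑' j, t (N + 1 + j) ≤ 1 →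
        ‖L - ∏ n ∈ Finset.Icc 1 N, (1 + f n)‖ ≤ C * ∑' j, t (N + 1 + j) := by
  have hprod : ∀ N, ∏ n ∈ Finset.Icc 1 N, (1 + f n) = ∏ n ∈ Finset.range N, (1 + f (n + 1)) := by
    intro N
    induction N with
    | zero => simp
    | succ N ih => rw [Finset.prod_Icc_succ_top (by omega), Finset.prod_range_succ, ih]
  have hs : Summable (fun n => ‖f (n + 1)‖) :=
    Summable.of_nonneg_of_le (fun _ => norm_nonneg _) (fun n => hf (n + 1) (by omega))
      ((summable_nat_add_iff 1).2 ht)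
  have hL := (multipliable_one_add_of_summable hs).hasProd.tendsto_prod_nat
  simp only [hprod]
  refine ⟨_, hL, 2 * Real.exp (∑' n, ‖f (n + 1)‖), by positivity, fun N hN => ?_⟩
  have hPN : ‖∏ n ∈ Finset.range N, (1 + f (n + 1))‖ ≤ Real.exp (∑' n, ‖f (n + 1)‖) := by
    have h1 := (Finset.range N).norm_prod_one_add_sub_one_le (fun n => f (n + 1))
    have h2 := norm_le_norm_sub_add (∏ n ∈ Finset.range N, (1 + f (n + 1))) 1
    rw [norm_one] at h2
    have h3 : Real.exp (∑ n ∈ Finset.range N, ‖f (n + 1)‖) ≤ Real.exp (∑' n, ‖f (n + 1)‖) :=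
      Real.exp_le_exp.2 (hs.sum_le_tsum _ fun _ _ => norm_nonneg _)
    linarith
  have htN : Summable (fun j => t (N + 1 + j)) := ht.comp_injective (add_right_injective _)
  have ht0 : ∀ j, 0 ≤ t (N + 1 + j) := fun j => (norm_nonneg _).trans (hf _ (by omega))
  have hT0 : 0 ≤ ∑' j, t (N + 1 + j) := tsum_nonneg ht0
  have hstep : ∀ m, ‖∏ n ∈ Finset.range (m + N), (1 + f (n + 1)) -
      ∏ n ∈ Finset.range N, (1 + f (n + 1))‖ ≤
      2 * Real.exp (∑' n, ‖f (n + 1)‖) * ∑' j, t (N + 1 + j) := by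
    intro m
    rw [add_comm m N, Finset.prod_range_add]
    have h1 := (Finset.range m).norm_prod_one_add_sub_one_le (fun n => f (N + n + 1))
    have h2 : ∑ n ∈ Finset.range m, ‖f (N + n + 1)‖ ≤ ∑' j, t (N + 1 + j) := by
      calc _ ≤ ∑ j ∈ Finset.range m, t (N + 1 + j) := by
            refine Finset.sum_le_sum fun j _ => ?_
            rw [show N + 1 + j = N + j + 1 by ring]
            exact hf _ (by omega)
        _ ≤ _ := htN.sum_le_tsum _ fun j _ => ht0 j
    have h3 := Real.abs_exp_sub_one_le (x := ∑' j, t (N + 1 + j)) (by rwa [abs_of_nonneg hT0])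
    rw [abs_of_nonneg hT0] at h3
    have h4 := Real.exp_le_exp.2 h2
    have h5 := (le_abs_self _).trans h3
    have h6 : ‖∏ n ∈ Finset.range m, (1 + f (N + n + 1)) - 1‖ ≤ 2 * ∑' j, t (N + 1 + j) := by
      linarith
    calc _ = ‖∏ n ∈ Finset.range N, (1 + f (n + 1))‖ *
          ‖∏ n ∈ Finset.range m, (1 + f (N + n + 1)) - 1‖ := by
          rw [← norm_mul, mul_sub, mul_one]
      _ ≤ Real.exp (∑' n, ‖f (n + 1)‖) * (2 * ∑' j, t (N + 1 + j)) := by gcongr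
      _ = _ := by ring
  refine le_of_tendsto (((tendsto_add_atTop_iff_nat N).2 hL).sub_const _).norm
    (Eventually.of_forall hstep)

lemma sum_rpow_le {α : ℝ} (hα0 : 0 < α) (hα1 : α < 1) {s : ℕ → ℝ} (hs0 : ∀ n, 0 ≤ s n) (N : ℕ) :
    ∑ n ∈ Finset.Icc 1 N, s n ^ α ≤
      (N : ℝ) ^ (1 - α) * (∑ n ∈ Finset.Icc 1 N, s n) ^ α := by
  have hp : 1 ≤ 1 / α := by rw [le_div_iff₀ hα0]; linarith
  have h := Real.rpow_sum_le_const_mul_sum_rpow_of_nonneg (Finset.Icc 1 N)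
    (f := fun n => s n ^ α) hp (fun n _ => Real.rpow_nonneg (hs0 n) α)
  have e : ∀ n, (s n ^ α) ^ (1 / α) = s n := fun n => by
    rw [← Real.rpow_mul (hs0 n), mul_one_div_cancel hα0.ne', Real.rpow_one]
  simp only [e, Nat.card_Icc, Nat.add_sub_cancel] at h
  have hW : 0 ≤ ∑ n ∈ Finset.Icc 1 N, s n ^ α :=
    Finset.sum_nonneg fun n _ => Real.rpow_nonneg (hs0 n) α
  have h2 := Real.rpow_le_rpow (by positivity) h hα0.le
  rw [← Real.rpow_mul hW, one_div_mul_cancel hα0.ne', Real.rpow_one,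
    Real.mul_rpow (by positivity) (Finset.sum_nonneg fun n _ => hs0 n),
    ← Real.rpow_mul (by positivity)] at h2
  rwa [show (1 / α - 1) * α = 1 - α by field_simp] at h2

lemma eventually_linear_le_sum {s : ℕ → ℝ} (hs0 : ∀ n, 0 ≤ s n) (hs : Tendsto s atTop atTop)
    (B : ℝ) : ∀ᶠ N : ℕ in atTop, B * N ≤ ∑ n ∈ Finset.Icc 1 N, s n := by
  obtain ⟨n1, hn1⟩ := eventually_atTop.1 (hs.eventually_ge_atTop (2 * |B|))
  have key : ∀ j, 2 * |B| * j ≤ ∑ n ∈ Finset.Icc 1 (n1 + j), s n := by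
    intro j
    induction j with
    | zero => simpa using Finset.sum_nonneg fun n _ => hs0 n
    | succ j ih =>
      rw [← add_assoc, Finset.sum_Icc_succ_top (by omega)]
      have := hn1 (n1 + j + 1) (by omega)
      push_cast
      linarith
  filter_upwards [eventually_ge_atTop (2 * n1)] with N hN
  have h := key (N - n1)
  rw [Nat.add_sub_cancel' (by omega), Nat.cast_sub (by omega)] at h
  have h2 : (2 * n1 : ℝ) ≤ N := by exact_mod_cast hN
  have h3 : B * N ≤ |B| * N := by gcongr; exact le_abs_self B
  have h4 : |B| * (2 * n1) ≤ |B| * N := by gcongr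
  linarith

lemma eventually_coord_exponent {α z c : ℝ} (hα0 : 0 < α) (hα1 : α < 1) (hz : 0 < z)
    {s : ℕ → ℝ} (hs0 : ∀ n, 0 ≤ s n) (hs : Tendsto s atTop atTop) {S W : ℕ → ℝ}
    (hS : ∀ N, S N = ∑ n ∈ Finset.Icc 1 N, s n) (hW : ∀ N, W N = ∑ n ∈ Finset.Icc 1 N, s n ^ α) :
    ∀ᶠ N : ℕ in atTop, ∀ l : ℝ, z * S N + W N ≤ l → c + N + 2 * W N ≤ N * l ^ α := by
  have hz' : 0 < z ^ α := by positivity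
  have t1 : Tendsto (fun N : ℕ => (N : ℝ) ^ α) atTop atTop :=
    (tendsto_rpow_atTop hα0).comp tendsto_natCast_atTop_atTop
  filter_upwards [eventually_linear_le_sum hs0 hs 1, t1.eventually_ge_atTop (4 / z ^ α),
    tendsto_natCast_atTop_atTop.eventually_ge_atTop c, eventually_ge_atTop 1]
    with N h1 h2 h3 h4 l hl
  rw [one_mul, ← hS] at h1
  have hN : (0 : ℝ) < N := by exact_mod_cast h4
  have hS0 : 0 < S N := hN.trans_le h1
  have hW0 : 0 ≤ W N := by rw [hW]; exact Finset.sum_nonneg fun n _ => Real.rpow_nonneg (hs0 n) α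
  have hWle : W N ≤ (N : ℝ) ^ (1 - α) * S N ^ α := by
    rw [hW, hS]; exact sum_rpow_le hα0 hα1 hs0 N
  have h5 : (N : ℝ) ^ α ≤ S N ^ α := Real.rpow_le_rpow hN.le h1 hα0.le
  have h6 : z ^ α * S N ^ α ≤ l ^ α := by
    rw [← Real.mul_rpow hz.le hS0.le]
    exact Real.rpow_le_rpow (by positivity) (by linarith) hα0.le
  rw [div_le_iff₀ hz'] at h2
  have e : (N : ℝ) ^ (1 - α) * (N : ℝ) ^ α = N := by
    rw [← Real.rpow_add hN]; simp
  have hSα : 0 < S N ^ α := by positivity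
  have hNα : 0 < (N : ℝ) ^ (1 - α) := by positivity
  have h7 : (N : ℝ) ^ (1 - α) * 4 ≤ N * z ^ α := by
    calc _ ≤ (N : ℝ) ^ (1 - α) * ((N : ℝ) ^ α * z ^ α) := by gcongr
      _ = _ := by rw [← mul_assoc, e]
  have h8 : 4 ≤ S N ^ α * z ^ α := h2.trans (by gcongr)
  have h9 : N * (z ^ α * S N ^ α) ≤ N * l ^ α := by gcongr
  have h10 : (N : ℝ) ^ (1 - α) * 4 * S N ^ α ≤ N * z ^ α * S N ^ α := by gcongr
  have h11 : (N : ℝ) * 4 ≤ N * (S N ^ α * z ^ α) := by gcongr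
  linarith

lemma eventually_approx_exponent {α z M c d : ℝ} (hα0 : 0 < α) (hα1 : α < 1) (hz : 0 < z)
    (hM : 0 < M) (hd : 0 ≤ d) {s : ℕ → ℝ} (hs0 : ∀ n, 0 ≤ s n) (hs : Tendsto s atTop atTop)
    {S W : ℕ → ℝ} (hS : ∀ N, S N = ∑ n ∈ Finset.Icc 1 N, s n)
    (hW : ∀ N, W N = ∑ n ∈ Finset.Icc 1 N, s n ^ α) :
    ∃ D : ℝ, 1 ≤ D ∧ ∀ᶠ N : ℕ in atTop, ∀ l : ℝ, 0 ≤ l → l ≤ z * S N + W N + 1 →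
      c + d * N * l ^ α + M / z * l < M * S N + D * N * S N ^ α + D * N := by
  have hMz : 0 < M / z := by positivity
  refine ⟨d * (z + 3) ^ α + M / z + 1, ?_, ?_⟩
  · have : 0 ≤ d * (z + 3) ^ α := by positivity
    linarith
  filter_upwards [eventually_linear_le_sum hs0 hs 1,
    tendsto_natCast_atTop_atTop.eventually_gt_atTop c, eventually_ge_atTop 1]
    with N h1 h3 h4 l hl0 hl
  rw [one_mul, ← hS] at h1
  have hN : (1 : ℝ) ≤ N := by exact_mod_cast h4
  have hS1 : 1 ≤ S N := hN.trans h1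
  have hS0 : 0 < S N := by linarith
  have hW1 : W N ≤ N * S N ^ α := by
    have : W N ≤ (N : ℝ) ^ (1 - α) * S N ^ α := by
      rw [hW, hS]; exact sum_rpow_le hα0 hα1 hs0 N
    refine this.trans ?_
    gcongr
    exact Real.rpow_le_self_of_one_le hN (by linarith)
  have hW2 : W N ≤ N + S N := by
    rw [hW, hS]
    have e : (N : ℝ) = ∑ n ∈ Finset.Icc 1 N, (1 : ℝ) := by simp
    rw [e]
    rw [← Finset.sum_add_distrib]
    refine Finset.sum_le_sum fun n _ => ?_
    rcases le_total (s n) 1 with h | h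
    · have := Real.rpow_le_one (hs0 n) h hα0.le
      linarith [hs0 n]
    · have := Real.rpow_le_self_of_one_le h hα1.le
      linarith
  have h5 : l ^ α ≤ (z + 3) ^ α * S N ^ α := by
    rw [← Real.mul_rpow (by positivity) hS0.le]
    exact Real.rpow_le_rpow hl0 (by linarith) hα0.le
  have h6 : d * N * l ^ α ≤ d * N * ((z + 3) ^ α * S N ^ α) := by gcongr
  have h7 : M / z * l ≤ M / z * (z * S N + N * S N ^ α + 1) := by gcongr; linarith
  have h8 : M / z * (z * S N) = M * S N := by field_simp
  have hSα : 0 < S N ^ α := by positivity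
  have h9 : 0 ≤ d * (z + 3) ^ α * N := by positivity
  have h10 : M / z * 1 ≤ M / z * N := by gcongr
  have h11 : 0 ≤ N * S N ^ α := by positivity
  linarith

/-- Lemma `InSpan` (good rational approximations in coordinates of a ℤ-basis of 𝒪_K). -/
theorem stmt_17 (K : IntermediateField ℚ ℂ) [FiniteDimensional ℚ K] (d : ℕ)
    (hd : Module.finrank ℚ K = d)
    (α δ ε β y z1 z2 M : ℝ)
    (hα : 0 < α ∧ α < 1) (hδ : 0 < δ) (hε : 0 < ε) (hβ : 0 ≤ β ∧ β < ε / (1 + ε))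
    (hy : β ≤ y) (hz1 : -y ≤ z1) (hz2 : 0 < z2)
    (a b : ℕ → ℂ) (r : ℕ → ℕ)
    (haK : ∀ n : ℕ, 1 ≤ n → a n ∈ K ∧ IsIntegral ℤ (a n) ∧ a n ≠ 0)
    (hbK : ∀ n : ℕ, 1 ≤ n → b n ∈ K ∧ IsIntegral ℤ (b n) ∧ b n ≠ 0)
    (hgrow : ∀ n : ℕ, 1 ≤ n → (n : ℝ) ^ (1 + ε) ≤ ‖a n‖ ∧
      ‖a n‖ ≤ ‖a (n + 1)‖)
    (hbn : ∀ n : ℕ, 1 ≤ n → ‖b n‖ < ‖a n‖ ^ (β) * 2 ^ (Real.logb 2 (‖a n‖) ^ α))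
    (hhouseb : ∀ n : ℕ, 1 ≤ n → house (b n) ≤ ‖a n‖ ^ (y) * 2 ^ (Real.logb 2 (‖a n‖) ^ α))
    (hinv : ∀ n : ℕ, 1 ≤ n → house ((a n)⁻¹) ≤ ‖a n‖ ^ (z1) * 2 ^ (Real.logb 2 (‖a n‖) ^ α))
    (hr : ∀ n : ℕ, 1 ≤ n → 0 < r n ∧
      (∃ t : ℂ, t ∈ K ∧ IsIntegral ℤ t ∧ a n = (r n : ℂ) * t) ∧
      (r n : ℝ) * ‖conjNorm (a n / (r n : ℂ))‖ ≤ ‖a n‖ ^ (z2) * 2 ^ (Real.logb 2 (‖a n‖) ^ α))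
    (hlimsup : Filter.limsup (fun n : ℕ =>
      ((‖a n‖ ^ ((((d : ℝ) * (y + z1 + z2) + z2 + δ) / (1 - β) + 1) ^ (-(n : ℝ))) : ℝ) : EReal)) Filter.atTop = ⊤)
    (hM : M = (d : ℝ) * (y + z1 + z2) + z2 + δ)
    (x : Fin d → ℂ)
    (hxK : ∀ i, x i ∈ K ∧ IsIntegral ℤ (x i))
    (hxind : LinearIndependent ℤ x)
    (hxspan : ∀ t : ℂ, t ∈ K → IsIntegral ℤ t →
      ∃ m : Fin d → ℤ, t = ∑ i, (m i : ℂ) * x i) :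
    ∃ L : ℂ,
      Tendsto (fun N => ∏ n ∈ Finset.Icc 1 N, (1 + b n / a n)) atTop (nhds L) ∧
      ∃ (p : Fin d → ℕ → ℤ) (q : ℕ → ℕ), (∀ N, 0 < q N) ∧
        (∀ᶠ N : ℕ in atTop, 2 ^ N < q N ∧ ∀ i, |(p i N : ℝ)| ≤
          2 ^ ((N : ℝ) * Real.logb 2 (q N : ℝ) ^ α) * (q N : ℝ) ^ (1 + (y + z1) / z2)) ∧
        (∃ᶠ N : ℕ in atTop, ‖L - (∑ i, (p i N : ℂ) * x i) / (q N : ℂ)‖ <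
          2 ^ (-((d : ℝ) * (N : ℝ) * Real.logb 2 (q N : ℝ) ^ α)) * (q N : ℝ) ^ (-(M / z2))) := by

  obtain ⟨hα0, hα1⟩ := hα
  obtain ⟨hβ0, hβ1⟩ := hβ
  have hg : 0 < 1 - β := by
    have : ε / (1 + ε) < 1 := by rw [div_lt_one (by linarith)]; linarith
    linarith
  have hgε : 1 < (1 - β) * (1 + ε) := by
    rw [lt_div_iff₀ (by linarith)] at hβ1
    linarith
  have hM0 : 0 < M := by
    have : 0 ≤ (d : ℝ) * (y + z1 + z2) := mul_nonneg (Nat.cast_nonneg d) (by linarith)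
    linarith
  rw [← hM] at hlimsup
  have hA1 : ∀ n : ℕ, 1 ≤ n → 1 ≤ ‖a n‖ := fun n hn =>
    (Real.one_le_rpow (by exact_mod_cast hn) (by linarith)).trans (hgrow n hn).1
  -- the logarithmic scale
  set s : ℕ → ℝ := fun n => if n = 0 then 0 else Real.logb 2 ‖a n‖ with hsdef
  have hs : ∀ n, 1 ≤ n → s n = Real.logb 2 ‖a n‖ := fun n hn => by
    simp only [hsdef, if_neg (show n ≠ 0 by omega)]
  have has : ∀ n, 1 ≤ n → ‖a n‖ = 2 ^ s n := fun n hn => by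
    rw [hs n hn, Real.rpow_logb (by norm_num) (by norm_num) (by linarith [hA1 n hn])]
  have hapow : ∀ n, 1 ≤ n → ∀ e : ℝ, ‖a n‖ ^ e * 2 ^ (Real.logb 2 ‖a n‖ ^ α) =
      2 ^ (e * s n + s n ^ α) := fun n hn e => by
    rw [← hs n hn, has n hn, ← Real.rpow_mul (by norm_num), ← Real.rpow_add (by norm_num),
      mul_comm e]
  have hs0 : ∀ n, 0 ≤ s n := by
    intro n
    rcases Nat.eq_zero_or_pos n with rfl | hn
    · simp [hsdef]
    · rw [hs n hn]; exact Real.logb_nonneg (by norm_num) (hA1 n hn)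
  have hmono : Monotone s := by
    refine monotone_nat_of_le_succ fun n => ?_
    rcases Nat.eq_zero_or_pos n with rfl | hn
    · simpa [hsdef] using hs0 1
    · rw [hs n hn, hs (n + 1) (by omega)]
      exact Real.logb_le_logb_of_le (by norm_num) (by linarith [hA1 n hn]) (hgrow n hn).2
  have hlog : ∀ n : ℕ, (1 + ε) * Real.logb 2 n ≤ s n := by
    intro n
    rcases Nat.eq_zero_or_pos n with rfl | hn
    · simp [hsdef]
    · have hn' : (0 : ℝ) < n := by exact_mod_cast hn
      rw [hs n hn, ← Real.logb_rpow_eq_mul_logb_of_pos hn']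
      exact Real.logb_le_logb_of_le (by norm_num) (by positivity) (hgrow n hn).1
  have hs_top : Tendsto s atTop atTop := by
    refine tendsto_atTop_mono hlog (Tendsto.const_mul_atTop (by linarith) ?_)
    exact (Real.tendsto_logb_atTop (by norm_num)).comp tendsto_natCast_atTop_atTop
  have hsup : ∀ B : ℝ, ∃ᶠ n in atTop, B * (M / (1 - β) + 1) ^ n < s n := by
    intro B
    have h1 := frequently_lt_of_lt_limsup (b := (((2 : ℝ) ^ B : ℝ) : EReal)) (by isBoundedDefault)
      (hlimsup ▸ EReal.coe_lt_top _)
    refine (h1.and_eventually (eventually_ge_atTop 1)).mono ?_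
    rintro n ⟨hn, hn1⟩
    have hn := EReal.coe_lt_coe_iff.1 hn
    have hT : 0 < M / (1 - β) + 1 := by positivity
    rw [has n hn1, ← Real.rpow_mul (by norm_num), Real.rpow_lt_rpow_left_iff (by norm_num),
      Real.rpow_neg hT.le, Real.rpow_natCast, ← div_eq_mul_inv, lt_div_iff₀ (by positivity)] at hn
    exact hn
  set S : ℕ → ℝ := fun N => ∑ n ∈ Finset.Icc 1 N, s n with hSdef
  set W : ℕ → ℝ := fun N => ∑ n ∈ Finset.Icc 1 N, s n ^ α with hWdef
  have hS0 : ∀ N, 0 ≤ S N := fun N => Finset.sum_nonneg fun n _ => hs0 n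
  have hW0 : ∀ N, 0 ≤ W N := fun N => Finset.sum_nonneg fun n _ => Real.rpow_nonneg (hs0 n) α
  obtain ⟨hsum, C', htail⟩ := tail_bound hα0 hα1 hg hε hM0 hgε hmono hs0 hlog hsup
    (S := S) (fun _ => rfl)
  -- the infinite product
  have hba : ∀ n, 1 ≤ n → ‖b n / a n‖ ≤ 2 ^ (-((1 - β) * s n) + s n ^ α) := by
    intro n hn
    rw [norm_div, div_le_iff₀ (by linarith [hA1 n hn])]
    refine (hbn n hn).le.trans (le_of_eq ?_)
    rw [hapow n hn, has n hn, ← Real.rpow_add (by norm_num)]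
    congr 1; ring
  obtain ⟨L, hL, CL, hCL, hLbound⟩ := exists_prod_limit hsum hba
  refine ⟨L, hL, ?_⟩
  -- the denominators
  have hden : ∀ n, 1 ≤ n → ∃ (m : ℕ) (u : ℂ), 0 < m ∧ (m : ℝ) ≤ 2 ^ (z2 * s n + s n ^ α) ∧
      u ∈ K ∧ IsIntegral ℤ u ∧ a n * u = m := by
    intro n hn
    obtain ⟨hr0, ⟨t, htK, htI, hat⟩, hle⟩ := hr n hn
    have hrC : (r n : ℂ) ≠ 0 := by exact_mod_cast hr0.ne'
    have ht0 : t ≠ 0 := fun h => (haK n hn).2.2 (by rw [hat, h, mul_zero])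
    obtain ⟨c, hc0, hc, u, huK, huI, hu⟩ := exists_mul_eq_conjNorm K htK htI ht0
    refine ⟨r n * c, u, by positivity, ?_, huK, huI, ?_⟩
    · rw [← hapow n hn z2]
      rw [hat, mul_div_cancel_left₀ t hrC, ← hc, ← hat] at hle
      exact_mod_cast hle
    · rw [hat, mul_assoc, hu]; push_cast; ring
  choose! m u hm0 hmle huK huI hmu using hden
  set X : ℕ → ℝ := fun N => 2 ^ (z2 * S N + W N) with hXdef
  have hX0 : ∀ N, 0 < X N := fun N => by positivity
  set Q : ℕ → ℕ := fun N => ∏ n ∈ Finset.Icc 1 N, m n with hQdef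
  have hQ0 : ∀ N, 0 < Q N := fun N =>
    Finset.prod_pos fun n hn => hm0 n (Finset.mem_Icc.1 hn).1
  have hQX : ∀ N, (Q N : ℝ) ≤ X N := by
    intro N
    simp only [hQdef, hXdef, hSdef, hWdef, Nat.cast_prod]
    rw [Finset.mul_sum, ← Finset.sum_add_distrib, Real.rpow_sum_of_pos (by norm_num)]
    exact Finset.prod_le_prod (fun _ _ => Nat.cast_nonneg _)
      fun n hn => hmle n (Finset.mem_Icc.1 hn).1
  set q : ℕ → ℕ := fun N => Q N * ⌈X N / Q N⌉₊ with hqdef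
  have hQR : ∀ N, (0 : ℝ) < Q N := fun N => by exact_mod_cast hQ0 N
  have hqX : ∀ N, X N ≤ q N := by
    intro N
    simp only [hqdef, Nat.cast_mul]
    rw [mul_comm, ← div_le_iff₀ (hQR N)]
    exact Nat.le_ceil _
  have hqX2 : ∀ N, (q N : ℝ) ≤ 2 * X N := by
    intro N
    simp only [hqdef, Nat.cast_mul]
    have h1 := (Nat.ceil_lt_add_one (div_pos (hX0 N) (hQR N)).le).le
    calc (Q N : ℝ) * ⌈X N / Q N⌉₊ ≤ Q N * (X N / Q N + 1) := by gcongr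
      _ = X N + Q N := by field_simp [(hQR N).ne']
      _ ≤ _ := by linarith [hQX N]
  have hqR : ∀ N, (0 : ℝ) < q N := fun N => (hX0 N).trans_le (hqX N)
  have hq0 : ∀ N, 0 < q N := fun N => by exact_mod_cast hqR N
  set l : ℕ → ℝ := fun N => Real.logb 2 (q N) with hldef
  have hql : ∀ N, (q N : ℝ) = 2 ^ l N := fun N =>
    (Real.rpow_logb (by norm_num) (by norm_num) (hqR N)).symm
  have hl1 : ∀ N, z2 * S N + W N ≤ l N := fun N => by
    rw [hldef, Real.le_logb_iff_rpow_le (by norm_num) (hqR N)]; exact hqX N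
  have hl2 : ∀ N, l N ≤ z2 * S N + W N + 1 := fun N => by
    rw [hldef, Real.logb_le_iff_le_rpow (by norm_num) (hqR N), Real.rpow_add_one (by norm_num),
      mul_comm]
    exact hqX2 N
  have hl0 : ∀ N, 0 ≤ l N := fun N =>
    (add_nonneg (mul_nonneg hz2.le (hS0 N)) (hW0 N)).trans (hl1 N)
  -- the numerators
  set P : ℕ → ℂ := fun N => ∏ n ∈ Finset.Icc 1 N, (1 + b n / a n) with hPdef
  have hPK : ∀ N, (q N : ℂ) * P N ∈ K := by
    intro N
    refine mul_mem (natCast_mem K _) (prod_mem fun n hn => ?_)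
    have hn := (Finset.mem_Icc.1 hn).1
    exact add_mem (one_mem K) (div_mem (hbK n hn).1 (haK n hn).1)
  have hPI : ∀ N, IsIntegral ℤ ((q N : ℂ) * P N) := by
    intro N
    have e : (q N : ℂ) * P N =
        (⌈X N / Q N⌉₊ : ℂ) * ∏ n ∈ Finset.Icc 1 N, (u n * (a n + b n)) := by
      simp only [hqdef, hPdef, hQdef, Nat.cast_mul, Nat.cast_prod]
      rw [mul_comm (∏ n ∈ Finset.Icc 1 N, (m n : ℂ)), mul_assoc, ← Finset.prod_mul_distrib]
      congr 1
      refine Finset.prod_congr rfl fun n hn => ?_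
      have hn := (Finset.mem_Icc.1 hn).1
      rw [← hmu n hn]
      field_simp [(haK n hn).2.2]
    rw [e]
    refine (isIntegral_natCast _).mul (IsIntegral.prod _ fun n hn => ?_)
    have hn := (Finset.mem_Icc.1 hn).1
    exact (huI n hn).mul ((haK n hn).2.1.add (hbK n hn).2.1)
  choose p hp using fun N => hxspan _ (hPK N) (hPI N)
  obtain ⟨Cx, hCx, hcoord⟩ := exists_coord_bound K hd x (fun i => (hxK i).1) hxind
  have hconj : ∀ N, ∀ σ : K →ₐ[ℚ] ℂ, ‖σ ⟨_, hPK N⟩‖ ≤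
      q N * 2 ^ (N + (y + z1) * S N + 2 * W N) := by
    intro N σ
    classical
    let a' : ℕ → K := fun n => if h : a n ∈ K then ⟨a n, h⟩ else 0
    let b' : ℕ → K := fun n => if h : b n ∈ K then ⟨b n, h⟩ else 0
    have ha' : ∀ n, 1 ≤ n → (a' n : ℂ) = a n := fun n hn => by
      simp only [a', dif_pos (haK n hn).1]
    have hb' : ∀ n, 1 ≤ n → (b' n : ℂ) = b n := fun n hn => by
      simp only [b', dif_pos (hbK n hn).1]
    have e : (⟨_, hPK N⟩ : K) = (q N : K) * ∏ n ∈ Finset.Icc 1 N, (1 + b' n * (a' n)⁻¹) := by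
      apply Subtype.ext
      change (q N : ℂ) * P N = K.val ((q N : K) * ∏ n ∈ Finset.Icc 1 N, (1 + b' n * (a' n)⁻¹))
      rw [map_mul, map_prod, map_natCast]
      congr 1
      refine Finset.prod_congr rfl fun n hn => ?_
      have hn := (Finset.mem_Icc.1 hn).1
      rw [map_add, map_one, map_mul, map_inv₀, IntermediateField.coe_val, ha' n hn, hb' n hn,
        div_eq_mul_inv]
    rw [e, map_mul, map_natCast, map_prod, norm_mul, Complex.norm_natCast, norm_prod]
    refine mul_le_mul_of_nonneg_left ?_ (Nat.cast_nonneg _)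
    have e2 : (N : ℝ) + (y + z1) * S N + 2 * W N =
        ∑ n ∈ Finset.Icc 1 N, (1 + (y + z1) * s n + 2 * s n ^ α) := by
      rw [Finset.sum_add_distrib, Finset.sum_add_distrib, ← Finset.mul_sum, ← Finset.mul_sum]
      simp [hSdef, hWdef]
    rw [e2, Real.rpow_sum_of_pos (by norm_num)]
    refine Finset.prod_le_prod (fun _ _ => norm_nonneg _) fun n hn => ?_
    have hn := (Finset.mem_Icc.1 hn).1
    have h1 := norm_algHom_le_house K σ (b' n)
    have h2 := norm_algHom_le_house K σ (a' n)⁻¹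
    rw [hb' n hn] at h1
    rw [IntermediateField.coe_inv, ha' n hn] at h2
    have h3 := h1.trans (hhouseb n hn)
    have h4 := h2.trans (hinv n hn)
    rw [hapow n hn] at h3 h4
    have h5 : ‖σ (b' n) * σ (a' n)⁻¹‖ ≤ 2 ^ ((y + z1) * s n + 2 * s n ^ α) := by
      rw [norm_mul]
      refine (mul_le_mul h3 h4 (norm_nonneg _) (by positivity)).trans (le_of_eq ?_)
      rw [← Real.rpow_add (by norm_num)]
      congr 1; ring
    have h6 : (1 : ℝ) ≤ 2 ^ ((y + z1) * s n + 2 * s n ^ α) := by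
      refine Real.one_le_rpow (by norm_num) ?_
      have := mul_nonneg (show 0 ≤ y + z1 by linarith) (hs0 n)
      have := Real.rpow_nonneg (hs0 n) α
      linarith
    rw [map_add, map_one, map_mul]
    refine (norm_add_le _ _).trans ?_
    rw [norm_one, add_assoc, Real.rpow_add (by norm_num), Real.rpow_one]
    linarith
  refine ⟨fun i N => p N i, q, hq0, ?_, ?_⟩
  · filter_upwards [eventually_linear_le_sum hs0 hs_top (2 / z2), eventually_ge_atTop 1,
      eventually_coord_exponent (c := Real.logb 2 Cx) hα0 hα1 hz2 hs0 hs_top (S := S) (W := W)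
        (fun _ => rfl) (fun _ => rfl)] with N h1 hN1 h2
    have hNR : (1 : ℝ) ≤ N := by exact_mod_cast hN1
    constructor
    · have h3 : (N : ℝ) < l N := by
        have : 2 * (N : ℝ) ≤ z2 * S N := by
          have := mul_le_mul_of_nonneg_left h1 hz2.le
          rwa [← mul_assoc, mul_div_cancel₀ _ hz2.ne'] at this
        linarith [hl1 N, hW0 N]
      have h4 : (2 : ℝ) ^ (N : ℝ) < q N := by
        rw [hql N]; exact Real.rpow_lt_rpow_of_exponent_lt (by norm_num) h3
      rw [Real.rpow_natCast] at h4
      exact_mod_cast h4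
    · intro i
      refine (hcoord (p N) ⟨_, hPK N⟩ (hp N) _ (hconj N) i).trans ?_
      have h3 := h2 (l N) (hl1 N)
      have h4 : (y + z1) * S N ≤ l N * ((y + z1) / z2) := by
        have h5 : z2 * S N ≤ l N := by linarith [hl1 N, hW0 N]
        have h6 : 0 ≤ (y + z1) / z2 := div_nonneg (by linarith) hz2.le
        calc (y + z1) * S N = z2 * S N * ((y + z1) / z2) := by field_simp
          _ ≤ _ := by gcongr
      rw [Real.rpow_add (hqR N), Real.rpow_one]
      have h5 : Cx = 2 ^ Real.logb 2 Cx :=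
        (Real.rpow_logb (by norm_num) (by norm_num) hCx).symm
      have h6 : Cx * 2 ^ (N + (y + z1) * S N + 2 * W N) ≤
          2 ^ (N * l N ^ α) * (q N : ℝ) ^ ((y + z1) / z2) := by
        rw [hql N, ← Real.rpow_mul (by norm_num), ← Real.rpow_add (by norm_num)]
        nth_rewrite 1 [h5]
        rw [← Real.rpow_add (by norm_num)]
        refine Real.rpow_le_rpow_of_exponent_le (by norm_num) ?_
        linarith
      calc Cx * (q N * 2 ^ (N + (y + z1) * S N + 2 * W N))
          = q N * (Cx * 2 ^ (N + (y + z1) * S N + 2 * W N)) := by ring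
        _ ≤ q N * (2 ^ (N * l N ^ α) * (q N : ℝ) ^ ((y + z1) / z2)) := by gcongr
        _ = _ := by simp only [hldef]; ring
  · have hC1 : 0 < |C'| + 1 := by positivity
    obtain ⟨D, hD1, hD⟩ := eventually_approx_exponent (d := d)
      (c := Real.logb 2 (CL * (|C'| + 1))) hα0 hα1 hz2 hM0 (Nat.cast_nonneg d) hs0 hs_top
      (S := S) (W := W) (fun _ => rfl) (fun _ => rfl)
    refine ((htail D (by linarith)).and_eventually (hD.and
      (tendsto_natCast_atTop_atTop.eventually_ge_atTop (Real.logb 2 (|C'| + 1))))).mono ?_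
    rintro N ⟨h1, h2, h3⟩
    set E := M * S N + D * N * S N ^ α + D * N with hE
    have h4 : ∑' j, (2 : ℝ) ^ (-((1 - β) * s (N + 1 + j)) + s (N + 1 + j) ^ α) ≤
        (|C'| + 1) * 2 ^ (-E) := by
      refine h1.trans ?_
      gcongr
      linarith [le_abs_self C']
    have h5 : (|C'| + 1) * (2 : ℝ) ^ (-E) ≤ 1 := by
      rw [Real.rpow_neg (by norm_num), ← div_eq_mul_inv, div_le_one (by positivity),
        ← Real.logb_le_iff_le_rpow (by norm_num) hC1]
      have := Real.rpow_nonneg (hS0 N) α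
      have hN0 : (0 : ℝ) ≤ N := Nat.cast_nonneg N
      have h6 : 0 ≤ M * S N := mul_nonneg hM0.le (hS0 N)
      have h7 : 0 ≤ D * N * S N ^ α := by positivity
      have h8 : 1 * (N : ℝ) ≤ D * N := by gcongr
      linarith
    have h6 := hLbound N (h4.trans h5)
    have h7 : (∑ i, (p N i : ℂ) * x i) / (q N : ℂ) = P N := by
      rw [← hp N, mul_div_cancel_left₀]
      exact_mod_cast (hq0 N).ne'
    rw [h7]
    refine h6.trans_lt ?_
    have h8 := h2 (l N) (hl0 N) (hl2 N)
    calc CL * ∑' j, (2 : ℝ) ^ (-((1 - β) * s (N + 1 + j)) + s (N + 1 + j) ^ α)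
        ≤ CL * ((|C'| + 1) * 2 ^ (-E)) := by gcongr
      _ = 2 ^ (Real.logb 2 (CL * (|C'| + 1)) + -E) := by
        rw [Real.rpow_add (by norm_num), Real.rpow_logb (by norm_num) (by norm_num)
          (by positivity), mul_assoc]
      _ < 2 ^ (-(d * N * l N ^ α) + l N * -(M / z2)) := by
        refine Real.rpow_lt_rpow_of_exponent_lt (by norm_num) ?_
        linarith
      _ = _ := by
        rw [Real.rpow_add (by norm_num), Real.rpow_mul (by norm_num), ← hql N]
end
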